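/- arXiv:2204.03274 — 3 statements merged into one kernel-verified Lean document; each statement's English description precedes it below -/
import Mathlib

section
/- The limit defining the Whitham kernel exists: for every x ≠ 0 the improper integral (1/π)·lim_{R→∞} ∫₀^R m(ξ)cos(xξ) dξ converges, so K is well defined. Moreover K is even, completely monotone on (0,∞), i.e. for every j ∈ ℕ and every x > 0 one has (−1)^j · K^{(j)}(x) > 0 (in particular K is positive, strictly decreasing and convex on (0,∞)), and K is integrable on ℝ with ∫_ℝ K(x) dx = 1. -/
open Real Filter MeasureTheory

/-- The Whitham symbol `m(ξ) = √(tanh ξ / ξ)`, with `m 0 = 1`. -/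
noncomputable def whithamSymbol (ξ : ℝ) : ℝ :=
  if ξ = 0 then 1 else Real.sqrt (Real.tanh ξ / ξ)

/-- The Whitham kernel, defined for `x ≠ 0` as the improper integral
`K(x) = (1/π)·lim_{R→∞} ∫₀^R m(ξ) cos(xξ) dξ`, and `K 0 = 0`. -/
noncomputable def whithamKernel (x : ℝ) : ℝ :=
  if x = 0 then 0 else
    limUnder atTop
      (fun R : ℝ => (1 / Real.pi) * ∫ ξ in (0:ℝ)..R, whithamSymbol ξ * Real.cos (x * ξ))

lemma sinh_le_mul_cosh {x : ℝ} (hx : 0 ≤ x) : Real.sinh x ≤ x * Real.cosh x := by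
  have hd : ∀ y : ℝ, HasDerivAt (fun t => t * Real.cosh t - Real.sinh t) (y * Real.sinh y) y := by
    intro y
    have := ((hasDerivAt_id' y).mul (Real.hasDerivAt_cosh y)).sub (Real.hasDerivAt_sinh y)
    rwa [one_mul, add_sub_cancel_left] at this
  have h := monotoneOn_of_deriv_nonneg (convex_Ici (0 : ℝ))
    (fun y _ => (hd y).continuousAt.continuousWithinAt)
    (fun y _ => (hd y).differentiableAt.differentiableWithinAt)
    (fun y hy => by
      rw [interior_Ici] at hy
      rw [(hd y).deriv]
      exact mul_nonneg hy.le (Real.sinh_nonneg_iff.2 hy.le))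
  have := h Set.self_mem_Ici (Set.mem_Ici.2 hx) hx
  simp at this
  exact this

lemma sinh_mul_cosh_gt {x : ℝ} (hx : 0 < x) : x < Real.sinh x * Real.cosh x := by
  have h := Real.self_lt_sinh_iff.2 hx
  nlinarith [Real.one_le_cosh x]

lemma normSq_sinh_add_mul_I (x y : ℝ) :
    Complex.normSq (Complex.sinh (x + y * Complex.I)) = Real.sinh x ^ 2 + Real.sin y ^ 2 := by
  rw [Complex.sinh_add, Complex.sinh_mul_I, Complex.cosh_mul_I, ← mul_assoc,
    ← Complex.ofReal_sinh, ← Complex.ofReal_cosh, ← Complex.ofReal_sin, ← Complex.ofReal_cos,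
    ← Complex.ofReal_mul, ← Complex.ofReal_mul, Complex.normSq_add_mul_I]
  nlinarith [Real.cosh_sq x, Real.sin_sq_add_cos_sq y]

lemma normSq_cosh_add_mul_I (x y : ℝ) :
    Complex.normSq (Complex.cosh (x + y * Complex.I)) = Real.sinh x ^ 2 + Real.cos y ^ 2 := by
  rw [Complex.cosh_add, Complex.sinh_mul_I, Complex.cosh_mul_I, ← mul_assoc,
    ← Complex.ofReal_sinh, ← Complex.ofReal_cosh, ← Complex.ofReal_sin, ← Complex.ofReal_cos,
    ← Complex.ofReal_mul, ← Complex.ofReal_mul, Complex.normSq_add_mul_I]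
  nlinarith [Real.cosh_sq x, Real.sin_sq_add_cos_sq y]

lemma normSq_tanh_add_mul_I (x y : ℝ) :
    Complex.normSq (Complex.tanh (x + y * Complex.I)) =
      (Real.sinh x ^ 2 + Real.sin y ^ 2) / (Real.sinh x ^ 2 + Real.cos y ^ 2) := by
  rw [Complex.tanh_eq_sinh_div_cosh, Complex.normSq_div, normSq_sinh_add_mul_I,
    normSq_cosh_add_mul_I]

lemma cosh_ne_zero_of_re_pos {x y : ℝ} (hx : 0 < x) :
    Complex.cosh (x + y * Complex.I) ≠ 0 := by
  rw [← Complex.normSq_pos, normSq_cosh_add_mul_I]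
  have := Real.sinh_pos_iff.2 hx
  positivity

lemma differentiableAt_tanh {z : ℂ} (hz : Complex.cosh z ≠ 0) :
    DifferentiableAt ℂ Complex.tanh z := by
  have : Complex.tanh = fun z => Complex.sinh z / Complex.cosh z :=
    funext Complex.tanh_eq_sinh_div_cosh
  rw [this]
  exact Complex.differentiable_sinh.differentiableAt.div
    Complex.differentiable_cosh.differentiableAt hz

lemma dslope_tanh_of_ne {z : ℂ} (hz : z ≠ 0) :
    dslope Complex.tanh 0 z = Complex.tanh z / z := by
  simp [dslope_of_ne _ hz, slope_def_field]

lemma dslope_tanh_zero : dslope Complex.tanh 0 0 = 1 := by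
  have : Complex.tanh = fun z => Complex.sinh z / Complex.cosh z :=
    funext Complex.tanh_eq_sinh_div_cosh
  have h := ((Complex.hasDerivAt_sinh 0).div (Complex.hasDerivAt_cosh 0) (by simp)).deriv
  rw [dslope_same, this]
  exact h.trans (by simp)

lemma differentiableAt_dslope_tanh {z : ℂ} (hz : Complex.cosh z ≠ 0) :
    DifferentiableAt ℂ (dslope Complex.tanh 0) z := by
  have hs : {z : ℂ | Complex.cosh z ≠ 0} ∈ nhds z :=
    (isOpen_ne_fun Complex.continuous_cosh continuous_const).mem_nhds hz
  have h0 : {z : ℂ | Complex.cosh z ≠ 0} ∈ nhds (0 : ℂ) :=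
    (isOpen_ne_fun Complex.continuous_cosh continuous_const).mem_nhds (by simp)
  exact ((Complex.differentiableOn_dslope h0).2
    (fun w hw => (differentiableAt_tanh hw).differentiableWithinAt)).differentiableAt hs

lemma add_mul_I_ne_zero_of_re_pos {x y : ℝ} (hx : 0 < x) : (x + y * Complex.I : ℂ) ≠ 0 := by
  intro h
  have := congrArg Complex.re h
  simp at this
  exact hx.ne' this

lemma im_dslope_tanh_neg {x y : ℝ} (hx : 0 < x) (hy : 0 < y) :
    (dslope Complex.tanh 0 (x + y * Complex.I)).im < 0 := by
  have hz := add_mul_I_ne_zero_of_re_pos (y := y) hx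
  have hc := cosh_ne_zero_of_re_pos (y := y) hx
  have hD := mul_pos (Complex.normSq_pos.2 hc) (Complex.normSq_pos.2 hz)
  have key : (dslope Complex.tanh 0 (x + y * Complex.I)).im =
      (x * (Real.sin y * Real.cos y) - y * (Real.sinh x * Real.cosh x)) /
        (Complex.normSq (Complex.cosh (x + y * Complex.I)) *
          Complex.normSq (x + y * Complex.I)) := by
    rw [dslope_tanh_of_ne hz, Complex.tanh_eq_sinh_div_cosh, div_div, Complex.div_im,
      ← Complex.normSq_mul, ← sub_div, Complex.sinh_add, Complex.cosh_add, Complex.sinh_mul_I,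
      Complex.cosh_mul_I, ← Complex.ofReal_sinh, ← Complex.ofReal_cosh, ← Complex.ofReal_sin,
      ← Complex.ofReal_cos]
    congr 1
    simp only [Complex.add_re, Complex.add_im, Complex.mul_re, Complex.mul_im, Complex.ofReal_re,
      Complex.ofReal_im, Complex.I_re, Complex.I_im]
    ring_nf
    have e1 := Real.cosh_sq x
    have e2 := Real.sin_sq_add_cos_sq y
    grind
  rw [key]
  refine div_neg_of_neg_of_pos ?_ hD
  have h1 := sinh_mul_cosh_gt hx
  have h2 : Real.sin y * Real.cos y ≤ y := by
    have := Real.sin_le (show (0:ℝ) ≤ 2 * y by positivity)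
    rw [Real.sin_two_mul] at this
    linarith
  nlinarith

lemma tanh_div_pos {x : ℝ} (hx : 0 < x) : 0 < Real.tanh x / x := by
  rw [Real.tanh_eq_sinh_div_cosh]
  have := Real.sinh_pos_iff.2 hx
  have := Real.cosh_pos x
  positivity

lemma dslope_tanh_ofReal {x : ℝ} (hx : 0 < x) :
    dslope Complex.tanh 0 (x : ℂ) = ((Real.tanh x / x : ℝ) : ℂ) := by
  rw [dslope_tanh_of_ne (by exact_mod_cast hx.ne')]
  push_cast
  rfl

lemma dslope_tanh_mem_slitPlane {x y : ℝ} (hx : 0 < x) (hy : 0 ≤ y) :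
    dslope Complex.tanh 0 (x + y * Complex.I) ∈ Complex.slitPlane := by
  rcases hy.eq_or_lt with rfl | hy
  · simp only [Complex.ofReal_zero, zero_mul, add_zero, dslope_tanh_ofReal hx]
    exact Complex.ofReal_mem_slitPlane.2 (tanh_div_pos hx)
  · exact Or.inr (im_dslope_tanh_neg hx hy).ne

/-- The holomorphic extension of the Whitham symbol to the open right half-plane. -/
noncomputable def whithamSymbolExt (z : ℂ) : ℂ := dslope Complex.tanh 0 z ^ (2⁻¹ : ℂ)

/-- The jump of the extended symbol across the imaginary axis. It vanishes where `tan s / s ≥ 0`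
and equals `√|tan s / s|` elsewhere. -/
noncomputable def whithamDensity (s : ℝ) : ℝ :=
  Real.sqrt ((|Real.tan s / s| - Real.tan s / s) / 2)

lemma whithamSymbolExt_ofReal {x : ℝ} (hx : 0 ≤ x) :
    whithamSymbolExt x = (whithamSymbol x : ℂ) := by
  rcases hx.eq_or_lt with rfl | hx
  · rw [whithamSymbolExt, Complex.ofReal_zero, dslope_tanh_zero]
    simp [whithamSymbol]
  · rw [whithamSymbolExt, dslope_tanh_ofReal hx, whithamSymbol, if_neg hx.ne',
      Real.sqrt_eq_rpow, Complex.ofReal_cpow (tanh_div_pos hx).le]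
    norm_num

lemma differentiableAt_whithamSymbolExt {x y : ℝ} (hx : 0 < x) (hy : 0 ≤ y) :
    DifferentiableAt ℂ whithamSymbolExt (x + y * Complex.I) :=
  (differentiableAt_dslope_tanh (cosh_ne_zero_of_re_pos hx)).cpow
    (differentiableAt_const _) (dslope_tanh_mem_slitPlane hx hy)

lemma differentiableAt_whithamSymbolExt_zero : DifferentiableAt ℂ whithamSymbolExt 0 :=
  (differentiableAt_dslope_tanh (by simp)).cpow (differentiableAt_const _)
    (by rw [dslope_tanh_zero]; exact Complex.one_mem_slitPlane)

lemma whithamSymbolExt_zero : whithamSymbolExt 0 = 1 := by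
  rw [whithamSymbolExt, dslope_tanh_zero, Complex.one_cpow]

lemma norm_whithamSymbolExt (z : ℂ) :
    ‖whithamSymbolExt z‖ = Real.sqrt ‖dslope Complex.tanh 0 z‖ := by
  have h : whithamSymbolExt z ^ 2 = dslope Complex.tanh 0 z :=
    Complex.cpow_nat_inv_pow _ two_ne_zero
  rw [← h, norm_pow, Real.sqrt_sq (norm_nonneg _)]

lemma norm_dslope_tanh_le {x y : ℝ} (hx : 0 < x) (hc : Real.cos y ≠ 0) :
    ‖dslope Complex.tanh 0 (x + y * Complex.I)‖ ≤ |Real.cos y|⁻¹ := by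
  have hz := add_mul_I_ne_zero_of_re_pos (y := y) hx
  have hs := Real.sinh_pos_iff.2 hx
  have hc2 : 0 < Real.cos y ^ 2 := by positivity
  refine abs_le_of_sq_le_sq' ?_ (by positivity) |>.2
  rw [← Complex.normSq_eq_norm_sq, dslope_tanh_of_ne hz, Complex.normSq_div,
    normSq_tanh_add_mul_I, Complex.normSq_add_mul_I, inv_pow, sq_abs, div_div, ← one_div,
    div_le_div_iff₀ (by positivity) hc2]
  have h1 : Real.sinh x ^ 2 ≤ x ^ 2 * Real.cosh x ^ 2 := by
    rw [← mul_pow]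
    have := sinh_le_mul_cosh hx.le
    gcongr
  have h2 : Real.sin y ^ 2 ≤ y ^ 2 := sq_le_sq.2 Real.abs_sin_le_abs
  have h3 := Real.cosh_sq x
  have h4 := Real.sin_sq_add_cos_sq y
  have h5 : 0 ≤ x ^ 2 * Real.sinh x ^ 2 * (1 - Real.cos y ^ 2) :=
    mul_nonneg (by positivity) (by nlinarith [sq_nonneg (Real.sin y)])
  rw [h3] at h1
  nlinarith [mul_le_mul_of_nonneg_right h2 hc2.le, mul_le_mul_of_nonneg_right h1 hc2.le,
    mul_nonneg (sq_nonneg (Real.sinh x)) (sq_nonneg y)]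

lemma norm_whithamSymbolExt_le_of_normSq_tanh_le {z : ℂ} (hz : z ≠ 0) {C : ℝ} (hC : 0 ≤ C)
    (h : Complex.normSq (Complex.tanh z) ≤ C ^ 4) :
    ‖whithamSymbolExt z‖ ≤ C / Real.sqrt ‖z‖ := by
  rw [norm_whithamSymbolExt, dslope_tanh_of_ne hz, norm_div, Real.sqrt_div (norm_nonneg _)]
  gcongr
  refine Real.sqrt_le_iff.2 ⟨hC, abs_le_of_sq_le_sq' ?_ (by positivity) |>.2⟩
  rw [← Complex.normSq_eq_norm_sq]
  linarith

lemma norm_whithamSymbolExt_le_rsqrt_cos {x y : ℝ} (hx : 0 < x) (hc : Real.cos y ≠ 0) :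
    ‖whithamSymbolExt (x + y * Complex.I)‖ ≤ (Real.sqrt |Real.cos y|)⁻¹ := by
  rw [norm_whithamSymbolExt, ← Real.sqrt_inv]
  exact Real.sqrt_le_sqrt (norm_dslope_tanh_le hx hc)

lemma norm_whithamSymbolExt_le_of_cos_sq {x y : ℝ} (hx : 0 < x) (hc : Real.cos y ^ 2 = 1) :
    ‖whithamSymbolExt (x + y * Complex.I)‖ ≤ 1 / Real.sqrt ‖(x + y * Complex.I : ℂ)‖ := by
  refine norm_whithamSymbolExt_le_of_normSq_tanh_le (add_mul_I_ne_zero_of_re_pos hx) zero_le_one ?_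
  rw [normSq_tanh_add_mul_I, hc, one_pow]
  refine div_le_one_of_le₀ ?_ (by positivity)
  nlinarith [Real.sin_sq_add_cos_sq y]

lemma norm_whithamSymbolExt_le_of_one_le {x y : ℝ} (hx : 1 ≤ x) :
    ‖whithamSymbolExt (x + y * Complex.I)‖ ≤ 2 / Real.sqrt ‖(x + y * Complex.I : ℂ)‖ := by
  have hx0 : 0 < x := by linarith
  refine norm_whithamSymbolExt_le_of_normSq_tanh_le (add_mul_I_ne_zero_of_re_pos hx0)
    zero_le_two ?_
  have h1 := Real.self_lt_sinh_iff.2 hx0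
  rw [normSq_tanh_add_mul_I]
  refine div_le_of_le_mul₀ (by positivity) (by positivity) ?_
  nlinarith [Real.sin_sq_add_cos_sq y, sq_nonneg (Real.cos y), sq_nonneg (Real.sinh x)]

/-- The boundary value of the extended symbol at `i s` for `s > 0`. -/
noncomputable def whithamSymbolBoundary (s : ℝ) : ℂ :=
  Real.sqrt ((|Real.tan s / s| + Real.tan s / s) / 2) - whithamDensity s * Complex.I

lemma tendsto_whithamSymbolExt {s : ℝ} (hs : 0 < s) (hc : Real.cos s ≠ 0) :
    Tendsto (fun ε : ℝ => whithamSymbolExt (ε + s * Complex.I)) (nhdsWithin 0 (Set.Ioi 0))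
      (nhds (whithamSymbolBoundary s)) := by
  set A : ℝ → ℂ := fun ε => dslope Complex.tanh 0 (ε + s * Complex.I) with hA
  have hcosh : Complex.cosh (s * Complex.I) ≠ 0 := by
    rw [Complex.cosh_mul_I, ← Complex.ofReal_cos]
    exact_mod_cast hc
  have hA0 : dslope Complex.tanh 0 (s * Complex.I) = ((Real.tan s / s : ℝ) : ℂ) := by
    rw [dslope_tanh_of_ne (by simp [hs.ne']), Complex.tanh_mul_I]
    push_cast
    field_simp
  have hlim : Tendsto A (nhdsWithin 0 (Set.Ioi 0)) (nhds ((Real.tan s / s : ℝ) : ℂ)) := by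
    rw [← hA0]
    refine (differentiableAt_dslope_tanh hcosh).continuousAt.tendsto.comp ?_
    refine tendsto_nhdsWithin_of_tendsto_nhds ?_
    exact Continuous.tendsto' (by fun_prop) _ _ (by simp)
  have hre := (Complex.continuous_re.tendsto _).comp hlim
  have hn := hlim.norm
  simp only [Complex.ofReal_re, Complex.norm_real, Real.norm_eq_abs] at hre hn
  have h1 := (Real.continuous_sqrt.tendsto _).comp ((hn.add hre).div_const 2)
  have h2 := (Real.continuous_sqrt.tendsto _).comp ((hn.sub hre).div_const 2)
  have h3 := ((Complex.continuous_ofReal.tendsto _).comp h1).sub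
    (((Complex.continuous_ofReal.tendsto _).comp h2).mul_const Complex.I)
  refine Tendsto.congr' ?_ h3
  filter_upwards [self_mem_nhdsWithin] with ε hε
  have him := im_dslope_tanh_neg hε hs
  apply Complex.ext
  · simp [whithamSymbolExt, Complex.cpow_inv_two_re, hA]
  · simp [whithamSymbolExt, Complex.cpow_inv_two_im_eq_neg_sqrt him, hA]

lemma whithamDensity_nonneg (s : ℝ) : 0 ≤ whithamDensity s := Real.sqrt_nonneg _

lemma measurable_whithamDensity : Measurable whithamDensity := by
  have : Measurable Real.tan := by
    rw [show Real.tan = fun x => Real.sin x / Real.cos x from funext Real.tan_eq_sin_div_cos]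
    fun_prop
  unfold whithamDensity
  fun_prop

lemma whithamDensity_pos {s : ℝ} (h1 : π / 2 < s) (h2 : s < π) : 0 < whithamDensity s := by
  have ht : Real.tan s < 0 := by
    rw [Real.tan_eq_sin_div_cos]
    exact div_neg_of_pos_of_neg (Real.sin_pos_of_pos_of_lt_pi (by linarith [Real.pi_pos]) h2)
      (Real.cos_neg_of_pi_div_two_lt_of_lt h1 (by linarith))
  have : Real.tan s / s < 0 := div_neg_of_neg_of_pos ht (by linarith [Real.pi_pos])
  refine Real.sqrt_pos.2 ?_
  rw [abs_of_neg this]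
  linarith

lemma intervalIntegrable_rsqrt_abs_cos (a b : ℝ) :
    IntervalIntegrable (fun s => (Real.sqrt |Real.cos s|)⁻¹) volume a b := by
  have h1 : IntervalIntegrable (fun s => (Real.sqrt |Real.sin s|)⁻¹) volume 0 (π / 2) := by
    have hr : IntervalIntegrable (fun s : ℝ => Real.sqrt (π / 2) * s ^ (-(1 / 2) : ℝ)) volume
        0 (π / 2) := (intervalIntegral.intervalIntegrable_rpow' (by norm_num)).const_mul _
    refine hr.mono_fun (Measurable.aestronglyMeasurable (by fun_prop)) ?_
    rw [Set.uIoc_of_le (by positivity)]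
    refine (ae_restrict_iff' measurableSet_Ioc).2 (ae_of_all _ fun s hs => ?_)
    have hp := Real.mul_le_sin hs.1.le hs.2
    have h0 : 0 < 2 / π * s := mul_pos (by positivity) hs.1
    have h00 := hs.1
    beta_reduce
    rw [Real.norm_of_nonneg (by positivity), Real.norm_of_nonneg (by positivity),
      abs_of_pos (h0.trans_le hp), Real.rpow_neg hs.1.le, ← Real.sqrt_eq_rpow, ← Real.sqrt_inv,
      ← Real.sqrt_inv, ← Real.sqrt_mul (by positivity)]
    refine Real.sqrt_le_sqrt ?_
    calc (Real.sin s)⁻¹ ≤ (2 / π * s)⁻¹ := by gcongr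
      _ = π / 2 * s⁻¹ := by field_simp
  have h2 : IntervalIntegrable (fun s => (Real.sqrt |Real.sin s|)⁻¹) volume (-(π / 2)) 0 := by
    have := h1.comp_mul_left (c := -1)
    simpa [div_neg] using this.symm
  have hper : Function.Periodic (fun s => (Real.sqrt |Real.sin s|)⁻¹) π := by
    intro s
    simp [Real.sin_add_pi]
  have h3 := hper.intervalIntegrable Real.pi_ne_zero (t := -(π / 2))
    (by convert h2.trans h1 using 1; ring) (a + π / 2) (b + π / 2)
  have h4 := h3.comp_add_right (π / 2)
  simpa [Real.sin_add_pi_div_two] using h4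

lemma ae_cos_ne_zero : ∀ᵐ s : ℝ, Real.cos s ≠ 0 := by
  have : {s : ℝ | Real.cos s = 0}.Countable := by
    refine (Set.countable_range fun k : ℤ => (2 * k + 1) * π / 2).mono ?_
    intro s hs
    obtain ⟨k, hk⟩ := Real.cos_eq_zero_iff.1 hs
    exact ⟨k, hk.symm⟩
  filter_upwards [this.ae_notMem volume] with s hs using hs

section Quadrant

variable {f : ℂ → ℂ} {g : ℝ → ℂ} {b : ℝ → ℝ} {R T : ℝ}

lemma aestronglyMeasurable_vertical
    (hd : ∀ x y : ℝ, 0 < x → 0 ≤ y → DifferentiableAt ℂ f (x + y * Complex.I))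
    {ε : ℝ} (hε : 0 < ε) (hT : 0 ≤ T) :
    AEStronglyMeasurable (fun y : ℝ => f (ε + y * Complex.I))
      (volume.restrict (Set.uIoc 0 T)) := by
  rw [Set.uIoc_of_le hT]
  refine ContinuousOn.aestronglyMeasurable (fun y hy => ?_) measurableSet_Ioc
  refine ContinuousAt.continuousWithinAt ?_
  exact ContinuousAt.comp (f := fun y : ℝ => (ε + y * Complex.I : ℂ)) (g := f)
    (hd ε y hε hy.1.le).continuousAt (by fun_prop)

lemma intervalIntegrable_boundary
    (hd : ∀ x y : ℝ, 0 < x → 0 ≤ y → DifferentiableAt ℂ f (x + y * Complex.I))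
    (hT : 0 ≤ T) (hb : IntervalIntegrable b volume 0 T)
    (hbd : ∀ᶠ ε : ℝ in nhdsWithin 0 (Set.Ioi 0), ∀ y ∈ Set.Ioc 0 T, Real.cos y ≠ 0 →
      ‖f (ε + y * Complex.I)‖ ≤ b y)
    (hg : ∀ y ∈ Set.Ioc 0 T, Real.cos y ≠ 0 →
      Tendsto (fun ε : ℝ => f (ε + y * Complex.I)) (nhdsWithin 0 (Set.Ioi 0)) (nhds (g y))) :
    IntervalIntegrable g volume 0 T := by
  have hcos := ae_restrict_of_ae (s := Set.uIoc 0 T) ae_cos_ne_zero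
  have hmem := ae_restrict_mem (μ := volume) (measurableSet_uIoc (a := (0 : ℝ)) (b := T))
  rw [Set.uIoc_of_le hT] at hcos hmem
  obtain ⟨u, hu⟩ := (nhdsWithin (0 : ℝ) (Set.Ioi 0)).exists_seq_tendsto
  obtain ⟨v, hv, hvpos⟩ : ∃ v : ℕ → ℝ, Tendsto v atTop (nhdsWithin 0 (Set.Ioi 0)) ∧
      ∀ n, 0 < v n := by
    have h := (hu.eventually self_mem_nhdsWithin)
    obtain ⟨N, hN⟩ := eventually_atTop.1 h
    exact ⟨fun n => u (n + N), hu.comp (tendsto_add_atTop_nat N), fun n => hN _ (by omega)⟩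
  refine hb.mono_fun ?_ ?_
  · refine aestronglyMeasurable_of_tendsto_ae atTop
      (f := fun n (y : ℝ) => f (v n + y * Complex.I))
      (fun n => aestronglyMeasurable_vertical hd (hvpos n) hT) ?_
    rw [Set.uIoc_of_le hT]
    filter_upwards [hcos, hmem] with y hy hyT
    exact (hg y hyT hy).comp hv
  · rw [Set.uIoc_of_le hT]
    filter_upwards [hcos, hmem] with y hy hyT
    refine (le_of_tendsto (hg y hyT hy).norm ?_).trans (le_abs_self _)
    filter_upwards [hbd] with ε hε using hε y hyT hy

/-- Cauchy's theorem on the rectangle `[0, R] × [0, T]`, for a function holomorphic away from the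
imaginary axis and having boundary values there almost everywhere. -/
lemma norm_integral_sub_boundary_le
    (hd : ∀ x y : ℝ, 0 < x → 0 ≤ y → DifferentiableAt ℂ f (x + y * Complex.I))
    (h0 : ContinuousAt f 0) (hR : 0 < R) (hT : 0 ≤ T) (hb : IntervalIntegrable b volume 0 T)
    (hbd : ∀ᶠ ε : ℝ in nhdsWithin 0 (Set.Ioi 0), ∀ y ∈ Set.Ioc 0 T, Real.cos y ≠ 0 →
      ‖f (ε + y * Complex.I)‖ ≤ b y)
    (hg : ∀ y ∈ Set.Ioc 0 T, Real.cos y ≠ 0 →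
      Tendsto (fun ε : ℝ => f (ε + y * Complex.I)) (nhdsWithin 0 (Set.Ioi 0)) (nhds (g y)))
    {M E : ℝ} (hM : ∀ x ∈ Set.Ioc 0 R, ‖f (x + T * Complex.I)‖ ≤ M)
    (hE : ‖∫ y in (0 : ℝ)..T, f (R + y * Complex.I)‖ ≤ E) :
    ‖(∫ x in (0 : ℝ)..R, f x) - Complex.I * ∫ y in (0 : ℝ)..T, g y‖ ≤ M * R + E := by
  have hM0 : 0 ≤ M := (norm_nonneg _).trans (hM R ⟨hR, le_rfl⟩)
  have hcont : ContinuousOn (fun x : ℝ => f x) (Set.Icc 0 R) := by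
    intro x hx
    refine ContinuousAt.continuousWithinAt
      (ContinuousAt.comp (f := fun y : ℝ => (y : ℂ)) (g := f) ?_ (by fun_prop))
    rcases hx.1.eq_or_lt with h | h
    · simpa [← h] using h0
    · simpa using (hd x 0 h le_rfl).continuousAt
  have hbot : Tendsto (fun ε : ℝ => ∫ x in ε..R, f x) (nhdsWithin 0 (Set.Ioi 0))
      (nhds (∫ x in (0 : ℝ)..R, f x)) := by
    have hint : IntegrableOn (fun x : ℝ => f x) (Set.uIcc 0 R) := by
      rw [Set.uIcc_of_le hR.le]
      exact hcont.integrableOn_Icc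
    have h := intervalIntegral.continuousOn_primitive_interval_left hint 0 Set.left_mem_uIcc
    rw [Set.uIcc_of_le hR.le] at h
    exact h.tendsto.mono_left (nhdsWithin_le_of_mem (Icc_mem_nhdsGT hR))
  have hleft : Tendsto (fun ε : ℝ => ∫ y in (0 : ℝ)..T, f (ε + y * Complex.I))
      (nhdsWithin 0 (Set.Ioi 0)) (nhds (∫ y in (0 : ℝ)..T, g y)) := by
    refine intervalIntegral.tendsto_integral_filter_of_dominated_convergence b ?_ ?_ hb ?_
    · filter_upwards [self_mem_nhdsWithin] with ε hε
      exact aestronglyMeasurable_vertical hd hε hT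
    · filter_upwards [hbd] with ε hε
      filter_upwards [ae_cos_ne_zero] with y hy hyT
      exact hε y (by rwa [Set.uIoc_of_le hT] at hyT) hy
    · filter_upwards [ae_cos_ne_zero] with y hy hyT
      exact hg y (by rwa [Set.uIoc_of_le hT] at hyT) hy
  refine le_of_tendsto (hbot.sub (hleft.const_mul Complex.I)).norm ?_
  filter_upwards [Ioo_mem_nhdsGT hR] with ε hε
  have hrect := Complex.integral_boundary_rect_eq_zero_of_differentiableOn f (ε : ℂ)
    (R + T * Complex.I) (by
      intro z hz
      have hz1 : ε ≤ z.re := by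
        have := hz.1
        simp [Set.uIcc_of_le hε.2.le] at this
        exact this.1
      have hz2 : 0 ≤ z.im := by
        have := hz.2
        simp [Set.uIcc_of_le hT] at this
        exact this.1
      have := hd z.re z.im (hε.1.trans_le hz1) hz2
      rw [Complex.re_add_im] at this
      exact this.differentiableWithinAt)
  simp only [Complex.ofReal_re, Complex.ofReal_im, Complex.add_re, Complex.mul_re, Complex.I_re,
    Complex.I_im, Complex.add_im, Complex.mul_im, mul_zero, mul_one, sub_zero, add_zero, zero_add,
    Complex.ofReal_zero, zero_mul, smul_eq_mul] at hrect
  have heq : (∫ x in ε..R, f x) - Complex.I * ∫ y in (0 : ℝ)..T, f (ε + y * Complex.I) =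
      (∫ x in ε..R, f (x + T * Complex.I)) -
        Complex.I * ∫ y in (0 : ℝ)..T, f (R + y * Complex.I) := by
    linear_combination hrect
  rw [heq]
  refine (norm_sub_le _ _).trans (add_le_add ?_ (by simpa using hE))
  refine (intervalIntegral.norm_integral_le_of_norm_le_const (C := M) fun x hx => ?_).trans ?_
  · rw [Set.uIoc_of_le hε.2.le] at hx
    exact hM x ⟨hε.1.trans hx.1, hx.2⟩
  · rw [abs_of_pos (by linarith [hε.2])]
    nlinarith [hε.1]

end Quadrant

/-- The extended symbol with its value at the origin removed by subtracting `1 / (1 + z)`, divided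
by `z`. -/
noncomputable def whithamQuotient (z : ℂ) : ℂ :=
  dslope (fun z => whithamSymbolExt z - (1 + z)⁻¹) 0 z

lemma whithamQuotient_of_ne {z : ℂ} (hz : z ≠ 0) :
    whithamQuotient z = (whithamSymbolExt z - (1 + z)⁻¹) / z := by
  simp [whithamQuotient, dslope_of_ne _ hz, slope_def_field, whithamSymbolExt_zero]

lemma continuousAt_whithamQuotient_zero : ContinuousAt whithamQuotient 0 := by
  refine continuousAt_dslope_same.2 ?_
  exact differentiableAt_whithamSymbolExt_zero.sub
    (((differentiableAt_const _).add differentiableAt_id).inv (by simp))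

lemma one_add_ne_zero_of_re_nonneg {z : ℂ} (hz : 0 ≤ z.re) : 1 + z ≠ 0 := by
  intro h
  have := congrArg Complex.re h
  simp at this
  linarith

lemma differentiableAt_whithamQuotient {x y : ℝ} (hx : 0 < x) (hy : 0 ≤ y) :
    DifferentiableAt ℂ whithamQuotient (x + y * Complex.I) := by
  refine (differentiableAt_dslope_of_ne (add_mul_I_ne_zero_of_re_pos hx)).2 ?_
  exact (differentiableAt_whithamSymbolExt hx hy).sub
    (((differentiableAt_const _).add differentiableAt_id).inv
      (one_add_ne_zero_of_re_nonneg (by simpa using hx.le)))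

lemma norm_inv_one_add_le {z : ℂ} (hz : 0 ≤ z.re) : ‖(1 + z)⁻¹‖ ≤ 1 := by
  rw [norm_inv]
  refine inv_le_one_of_one_le₀ ?_
  have := Complex.re_le_norm (1 + z)
  simp at this
  linarith

lemma norm_inv_one_add_le_inv {z : ℂ} (hz : 0 ≤ z.re) (hz0 : z ≠ 0) :
    ‖(1 + z)⁻¹‖ ≤ ‖z‖⁻¹ := by
  rw [norm_inv]
  have h0 : 0 < ‖z‖ := norm_pos_iff.2 hz0
  gcongr
  refine abs_le_of_sq_le_sq' ?_ (norm_nonneg _) |>.2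
  rw [← Complex.normSq_eq_norm_sq, ← Complex.normSq_eq_norm_sq, Complex.normSq_apply,
    Complex.normSq_apply]
  simp
  nlinarith

lemma norm_whithamQuotient_le {z : ℂ} (hz : 0 ≤ z.re) {C T : ℝ} (hC : 0 ≤ C) (hT : 1 ≤ T)
    (hTz : T ≤ ‖z‖) (h : ‖whithamSymbolExt z‖ ≤ C / Real.sqrt ‖z‖) :
    ‖whithamQuotient z‖ ≤ (C + 1) / Real.sqrt T / T := by
  have hz1 : 1 ≤ ‖z‖ := hT.trans hTz
  have hz0 : z ≠ 0 := norm_pos_iff.1 (by linarith)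
  have hsq : Real.sqrt ‖z‖ ≤ ‖z‖ := Real.sqrt_le_self_iff.2 (Or.inr hz1)
  have hsp : 0 < Real.sqrt T := Real.sqrt_pos.2 (by linarith)
  have hsz : Real.sqrt T ≤ Real.sqrt ‖z‖ := Real.sqrt_le_sqrt hTz
  rw [whithamQuotient_of_ne hz0, norm_div]
  have hnum : ‖whithamSymbolExt z - (1 + z)⁻¹‖ ≤ (C + 1) / Real.sqrt T := by
    refine (norm_sub_le _ _).trans ?_
    rw [add_div]
    refine add_le_add (h.trans (by gcongr)) ((norm_inv_one_add_le_inv hz hz0).trans ?_)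
    rw [one_div]
    gcongr
    exact hsz.trans hsq
  gcongr

lemma exists_bound_whithamQuotient : ∃ C δ : ℝ, 0 < δ ∧ ∀ x y : ℝ, 0 < x → Real.cos y ≠ 0 →
    ‖whithamQuotient (x + y * Complex.I)‖ ≤ C + ((Real.sqrt |Real.cos y|)⁻¹ + 1) / δ := by
  have h := (continuousAt_whithamQuotient_zero.norm).eventually_lt_const
    (lt_add_one ‖whithamQuotient 0‖)
  obtain ⟨δ, hδ, hC⟩ := Metric.eventually_nhds_iff.1 h
  refine ⟨‖whithamQuotient 0‖ + 1, δ, hδ, fun x y hx hy => ?_⟩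
  set z : ℂ := x + y * Complex.I with hzdef
  by_cases hz : ‖z‖ < δ
  · have h1 := hC (show dist z 0 < δ by simpa using hz)
    have h2 : 0 ≤ ((Real.sqrt |Real.cos y|)⁻¹ + 1) / δ := by positivity
    linarith
  · push Not at hz
    have hre : 0 ≤ z.re := by simpa [hzdef] using hx.le
    have h1 : ‖whithamQuotient z‖ ≤ ((Real.sqrt |Real.cos y|)⁻¹ + 1) / δ := by
      rw [whithamQuotient_of_ne (add_mul_I_ne_zero_of_re_pos hx), norm_div]
      have : ‖whithamSymbolExt z - (1 + z)⁻¹‖ ≤ (Real.sqrt |Real.cos y|)⁻¹ + 1 :=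
        (norm_sub_le _ _).trans (add_le_add (norm_whithamSymbolExt_le_rsqrt_cos hx hy)
          (norm_inv_one_add_le hre))
      gcongr
    linarith [norm_nonneg (whithamQuotient 0)]

/-- The boundary value of `whithamQuotient` at `i y` for `y > 0`. -/
noncomputable def whithamQuotientBoundary (y : ℝ) : ℂ :=
  (whithamSymbolBoundary y - (1 + y * Complex.I)⁻¹) / (y * Complex.I)

lemma tendsto_whithamQuotient {y : ℝ} (hy : 0 < y) (hc : Real.cos y ≠ 0) :
    Tendsto (fun ε : ℝ => whithamQuotient (ε + y * Complex.I)) (nhdsWithin 0 (Set.Ioi 0))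
      (nhds (whithamQuotientBoundary y)) := by
  have hz : Tendsto (fun ε : ℝ => (ε + y * Complex.I : ℂ)) (nhdsWithin 0 (Set.Ioi 0))
      (nhds (y * Complex.I)) :=
    tendsto_nhdsWithin_of_tendsto_nhds (Continuous.tendsto' (by fun_prop) _ _ (by simp))
  have h := ((tendsto_whithamSymbolExt hy hc).sub
    ((hz.const_add 1).inv₀ (one_add_ne_zero_of_re_nonneg (by simp)))).div hz
      (by simp [hy.ne'])
  refine h.congr' ?_
  filter_upwards [self_mem_nhdsWithin] with ε hε
  exact (whithamQuotient_of_ne (add_mul_I_ne_zero_of_re_pos hε)).symm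

lemma whithamQuotientBoundary_re {y : ℝ} (hy : y ≠ 0) :
    (whithamQuotientBoundary y).re = (1 + y ^ 2)⁻¹ - whithamDensity y / y := by
  have h1 : ∀ w : ℂ, (w / (y * Complex.I)).re = w.im / y := by
    intro w
    rw [mul_comm, ← div_div, Complex.div_ofReal_re, Complex.div_I]
    simp
  rw [whithamQuotientBoundary, h1, whithamSymbolBoundary]
  have h2 : ((1 + y * Complex.I : ℂ)⁻¹).im = -y / (1 + y ^ 2) := by
    rw [Complex.inv_im]
    have := Complex.normSq_add_mul_I 1 y
    simp at this
    simp [this]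
  rw [Complex.sub_im, h2]
  simp
  field_simp
  ring

lemma intervalIntegrable_whithamQuotientBoundary {T : ℝ} (hT : 0 ≤ T) :
    IntervalIntegrable whithamQuotientBoundary volume 0 T := by
  obtain ⟨C, δ, -, hb⟩ := exists_bound_whithamQuotient
  refine intervalIntegrable_boundary (f := whithamQuotient)
    (b := fun y => C + ((Real.sqrt |Real.cos y|)⁻¹ + 1) / δ)
    (fun x y hx hy => differentiableAt_whithamQuotient hx hy) hT ?_ ?_
    (fun y hy hc => tendsto_whithamQuotient hy.1 hc)
  · exact intervalIntegrable_const.add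
      (((intervalIntegrable_rsqrt_abs_cos 0 T).add intervalIntegrable_const).div_const δ)
  · filter_upwards [self_mem_nhdsWithin] with ε hε y _ hc using hb ε y hε hc

lemma abs_integral_re_whithamQuotientBoundary_le {n : ℕ} (hn : n ≠ 0) :
    |∫ y in (0 : ℝ)..n * π, (whithamQuotientBoundary y).re| ≤ 5 / Real.sqrt (n * π) := by
  obtain ⟨C, δ, -, hb⟩ := exists_bound_whithamQuotient
  set T : ℝ := n * π with hTdef
  have hT1 : 1 ≤ T := by
    have : (1 : ℝ) ≤ n := by exact_mod_cast Nat.one_le_iff_ne_zero.2 hn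
    nlinarith [Real.pi_gt_three]
  have hT : 0 < T := by linarith
  have hcosT : Real.cos T ^ 2 = 1 := by
    rw [hTdef, Real.cos_nat_mul_pi, ← pow_mul, mul_comm, pow_mul]
    simp
  have hleT : ∀ y : ℝ, T ≤ ‖(T + y * Complex.I : ℂ)‖ := fun y => by
    simpa using (le_abs_self _).trans (Complex.abs_re_le_norm (T + y * Complex.I : ℂ))
  have hleT' : ∀ x : ℝ, T ≤ ‖(x + T * Complex.I : ℂ)‖ := fun x => by
    simpa using (le_abs_self _).trans (Complex.abs_im_le_norm (x + T * Complex.I : ℂ))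
  have key := norm_integral_sub_boundary_le (f := whithamQuotient) (g := whithamQuotientBoundary)
    (b := fun y => C + ((Real.sqrt |Real.cos y|)⁻¹ + 1) / δ) (R := T) (T := T)
    (M := (1 + 1) / Real.sqrt T / T) (E := (2 + 1) / Real.sqrt T)
    (fun x y hx hy => differentiableAt_whithamQuotient hx hy) continuousAt_whithamQuotient_zero
    hT hT.le
    (intervalIntegrable_const.add
      (((intervalIntegrable_rsqrt_abs_cos 0 T).add intervalIntegrable_const).div_const δ))
    (by filter_upwards [self_mem_nhdsWithin] with ε hε y _ hc using hb ε y hε hc)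
    (fun y hy hc => tendsto_whithamQuotient hy.1 hc)
    (fun x hx => norm_whithamQuotient_le (by simpa using hx.1.le) zero_le_one hT1 (hleT' x)
      (norm_whithamSymbolExt_le_of_cos_sq hx.1 hcosT))
    (by
      refine (intervalIntegral.norm_integral_le_of_norm_le_const fun y _ =>
        norm_whithamQuotient_le (by simpa using hT.le) zero_le_two hT1 (hleT y)
          (norm_whithamSymbolExt_le_of_one_le hT1)).trans_eq ?_
      rw [sub_zero, abs_of_pos hT]
      field_simp)
  have hreal : (∫ x in (0 : ℝ)..T, whithamQuotient x).im = 0 := by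
    have : (∫ x in (0 : ℝ)..T, whithamQuotient x) =
        ∫ x in (0 : ℝ)..T, (((whithamSymbol x - (1 + x)⁻¹) / x : ℝ) : ℂ) := by
      refine intervalIntegral.integral_congr_ae (ae_of_all _ fun x hx => ?_)
      rw [Set.uIoc_of_le hT.le] at hx
      rw [whithamQuotient_of_ne (by exact_mod_cast hx.1.ne'), whithamSymbolExt_ofReal hx.1.le]
      push_cast
      rfl
    rw [this, intervalIntegral.integral_ofReal, Complex.ofReal_im]
  have hre : (∫ y in (0 : ℝ)..T, whithamQuotientBoundary y).re =
      ∫ y in (0 : ℝ)..T, (whithamQuotientBoundary y).re :=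
    (Complex.reCLM.intervalIntegral_comp_comm
      (intervalIntegrable_whithamQuotientBoundary hT.le)).symm
  have him := (Complex.abs_im_le_norm _).trans key
  rw [Complex.sub_im, hreal, zero_sub, abs_neg, Complex.I_mul_im, hre] at him
  refine him.trans_eq ?_
  field_simp
  norm_num

lemma integrableOn_and_integral_whithamDensity_div :
    IntegrableOn (fun s => whithamDensity s / s) (Set.Ioi 0) ∧
      ∫ s in Set.Ioi 0, whithamDensity s / s = π / 2 := by
  have hT : Tendsto (fun n : ℕ => (n : ℝ) * π) atTop atTop :=
    tendsto_natCast_atTop_atTop.atTop_mul_const Real.pi_pos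
  have hcong : ∀ T : ℝ, 0 ≤ T → Set.EqOn (fun y => (1 + y ^ 2)⁻¹ - (whithamQuotientBoundary y).re)
      (fun s => whithamDensity s / s) (Set.uIoc 0 T) := by
    intro T hT y hy
    rw [Set.uIoc_of_le hT] at hy
    simp [whithamQuotientBoundary_re hy.1.ne']
  have hinv : ∀ T : ℝ, IntervalIntegrable (fun y : ℝ => (1 + y ^ 2)⁻¹) volume 0 T := fun T =>
    (Continuous.inv₀ (by fun_prop) fun y => by positivity).intervalIntegrable _ _
  have hreint : ∀ T : ℝ, 0 ≤ T →
      IntervalIntegrable (fun y => (whithamQuotientBoundary y).re) volume 0 T := fun T hT =>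
    ⟨(intervalIntegrable_whithamQuotientBoundary hT).1.re,
      (intervalIntegrable_whithamQuotientBoundary hT).2.re⟩
  have hint : ∀ T : ℝ, 0 ≤ T →
      IntervalIntegrable (fun s => whithamDensity s / s) volume 0 T := fun T hT =>
    ((hinv T).sub (hreint T hT)).congr (hcong T hT)
  have hval : ∀ T : ℝ, 0 ≤ T → ∫ s in (0 : ℝ)..T, whithamDensity s / s =
      Real.arctan T - ∫ y in (0 : ℝ)..T, (whithamQuotientBoundary y).re := by
    intro T hT
    rw [← intervalIntegral.integral_congr_ae (ae_of_all _ fun y hy => hcong T hT hy),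
      intervalIntegral.integral_sub (hinv T) (hreint T hT), integral_inv_one_add_sq,
      Real.arctan_zero, sub_zero]
  have hlim : Tendsto (fun n : ℕ => ∫ s in (0 : ℝ)..n * π, whithamDensity s / s) atTop
      (nhds (π / 2)) := by
    have h1 : Tendsto (fun n : ℕ => ∫ y in (0 : ℝ)..n * π, (whithamQuotientBoundary y).re) atTop
        (nhds 0) := by
      refine squeeze_zero_norm' (a := fun n : ℕ => 5 / Real.sqrt (n * π)) ?_ ?_
      · filter_upwards [eventually_ne_atTop 0] with n hn
        exact abs_integral_re_whithamQuotientBoundary_le hn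
      · exact tendsto_const_nhds.div_atTop (Real.tendsto_sqrt_atTop.comp hT)
    have h2 := ((Real.tendsto_arctan_atTop.mono_right nhdsWithin_le_nhds).comp hT).sub h1
    rw [sub_zero] at h2
    exact h2.congr fun n => (hval _ (by positivity)).symm
  have hI : IntegrableOn (fun s => whithamDensity s / s) (Set.Ioi 0) := by
    refine integrableOn_Ioi_of_intervalIntegral_norm_tendsto (π / 2) 0
      (fun n : ℕ => ((intervalIntegrable_iff_integrableOn_Ioc_of_le (by positivity)).1
        (hint (n * π) (by positivity)))) hT (hlim.congr fun n => ?_)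
    refine intervalIntegral.integral_congr_ae (ae_of_all _ fun y hy => ?_)
    rw [Set.uIoc_of_le (by positivity)] at hy
    rw [Real.norm_of_nonneg (div_nonneg (whithamDensity_nonneg y) hy.1.le)]
  exact ⟨hI, tendsto_nhds_unique (intervalIntegral_tendsto_integral_Ioi 0 hI hT) hlim⟩

lemma integrableOn_whithamDensity_mul_exp {x : ℝ} (hx : 0 < x) :
    IntegrableOn (fun s => whithamDensity s * Real.exp (-x * s)) (Set.Ioi 0) := by
  refine Integrable.mono' (integrableOn_and_integral_whithamDensity_div.1.const_mul x⁻¹)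
    (measurable_whithamDensity.mul (by fun_prop)).aestronglyMeasurable ?_
  refine (ae_restrict_iff' measurableSet_Ioi).2 (ae_of_all _ fun s (hs : 0 < s) => ?_)
  have hw := whithamDensity_nonneg s
  rw [Real.norm_of_nonneg (by positivity), neg_mul, Real.exp_neg]
  have h : (Real.exp (x * s))⁻¹ ≤ (x * s)⁻¹ := by
    gcongr
    linarith [Real.add_one_le_exp (x * s)]
  calc whithamDensity s * (Real.exp (x * s))⁻¹ ≤ whithamDensity s * (x * s)⁻¹ := by gcongr
    _ = x⁻¹ * (whithamDensity s / s) := by field_simp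

lemma abs_integral_whithamSymbol_mul_cos_sub_le {x R : ℝ} (hx : 0 < x) (hR : 1 ≤ R) {n : ℕ}
    (hn : n ≠ 0) :
    |(∫ ξ in (0 : ℝ)..R, whithamSymbol ξ * Real.cos (x * ξ)) -
      ∫ s in (0 : ℝ)..n * π, whithamDensity s * Real.exp (-x * s)| ≤
    Real.exp (-x * (n * π)) * R + 2 / Real.sqrt R * x⁻¹ := by
  set T : ℝ := n * π with hTdef
  have hT1 : 1 ≤ T := by
    have : (1 : ℝ) ≤ n := by exact_mod_cast Nat.one_le_iff_ne_zero.2 hn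
    nlinarith [Real.pi_gt_three]
  have hT : 0 < T := by linarith
  have hR0 : 0 < R := by linarith
  have hcosT : Real.cos T ^ 2 = 1 := by
    rw [hTdef, Real.cos_nat_mul_pi, ← pow_mul, mul_comm, pow_mul]
    simp
  set f : ℂ → ℂ := fun z => whithamSymbolExt z * Complex.exp (Complex.I * x * z) with hf
  set g : ℝ → ℂ := fun s => whithamSymbolBoundary s * Real.exp (-x * s) with hg
  have hnexp : ∀ t y : ℝ, ‖Complex.exp (Complex.I * x * (t + y * Complex.I))‖ =
      Real.exp (-x * y) := by
    intro t y
    rw [Complex.norm_exp]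
    simp
  have hd : ∀ t y : ℝ, 0 < t → 0 ≤ y → DifferentiableAt ℂ f (t + y * Complex.I) :=
    fun t y ht hy => (differentiableAt_whithamSymbolExt ht hy).mul (by fun_prop)
  have h0 : ContinuousAt f 0 :=
    differentiableAt_whithamSymbolExt_zero.continuousAt.mul (by fun_prop)
  have hbd : ∀ᶠ ε : ℝ in nhdsWithin 0 (Set.Ioi 0), ∀ y ∈ Set.Ioc 0 T, Real.cos y ≠ 0 →
      ‖f (ε + y * Complex.I)‖ ≤ (Real.sqrt |Real.cos y|)⁻¹ := by
    filter_upwards [self_mem_nhdsWithin] with ε hε y hy hc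
    rw [hf, norm_mul, hnexp]
    refine (mul_le_of_le_one_right (norm_nonneg _) (Real.exp_le_one_iff.2 ?_)).trans
      (norm_whithamSymbolExt_le_rsqrt_cos hε hc)
    nlinarith [hy.1]
  have hlim : ∀ y ∈ Set.Ioc 0 T, Real.cos y ≠ 0 →
      Tendsto (fun ε : ℝ => f (ε + y * Complex.I)) (nhdsWithin 0 (Set.Ioi 0)) (nhds (g y)) := by
    intro y hy hc
    refine (tendsto_whithamSymbolExt hy.1 hc).mul
      (tendsto_nhdsWithin_of_tendsto_nhds (Continuous.tendsto' (by fun_prop) _ _ ?_))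
    push_cast
    congr 1
    linear_combination (x * y : ℂ) * Complex.I_mul_I
  have hgint : IntervalIntegrable g volume 0 T :=
    intervalIntegrable_boundary hd hT.le (intervalIntegrable_rsqrt_abs_cos 0 T) hbd hlim
  have key := norm_integral_sub_boundary_le hd h0 hR0 hT.le
    (intervalIntegrable_rsqrt_abs_cos 0 T) hbd hlim
    (M := Real.exp (-x * T)) (E := 2 / Real.sqrt R * x⁻¹)
    (fun t ht => by
      rw [hf, norm_mul, hnexp]
      refine mul_le_of_le_one_left (Real.exp_pos _).le
        ((norm_whithamSymbolExt_le_of_cos_sq ht.1 hcosT).trans ?_)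
      refine div_le_one_of_le₀ (Real.one_le_sqrt.2 ?_) (Real.sqrt_nonneg _)
      have := (le_abs_self _).trans (Complex.abs_im_le_norm (t + T * Complex.I : ℂ))
      simp at this
      linarith)
    (by
      have hexp : IntervalIntegrable (fun y : ℝ => 2 / Real.sqrt R * Real.exp (-x * y)) volume
          0 T := Continuous.intervalIntegrable (by fun_prop) _ _
      refine (intervalIntegral.norm_integral_le_of_norm_le hT.le
        (ae_of_all _ fun y hy => ?_) hexp).trans ?_
      · rw [hf, norm_mul, hnexp]
        gcongr
        refine (norm_whithamSymbolExt_le_of_one_le hR).trans ?_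
        gcongr
        have := (le_abs_self _).trans (Complex.abs_re_le_norm (R + y * Complex.I : ℂ))
        simpa using this
      · rw [intervalIntegral.integral_const_mul]
        gcongr
        rw [intervalIntegral.integral_of_le hT.le]
        have hI : ∫ y in Set.Ioi (0 : ℝ), Real.exp (-x * y) = x⁻¹ := by
          rw [integral_exp_mul_Ioi (by linarith)]
          simp
        rw [← hI]
        exact setIntegral_mono_set (exp_neg_integrableOn_Ioi 0 hx)
          (ae_of_all _ fun y => (Real.exp_pos _).le) Set.Ioc_subset_Ioi_self.eventuallyLE)
  have hre1 : (∫ t in (0 : ℝ)..R, f t).re =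
      ∫ ξ in (0 : ℝ)..R, whithamSymbol ξ * Real.cos (x * ξ) := by
    have hfint : IntervalIntegrable (fun t : ℝ => f t) volume 0 R := by
      refine ContinuousOn.intervalIntegrable ?_
      intro t ht
      rw [Set.uIcc_of_le hR0.le] at ht
      refine ContinuousAt.continuousWithinAt
        (ContinuousAt.comp (f := fun y : ℝ => (y : ℂ)) (g := f) ?_ (by fun_prop))
      rcases ht.1.eq_or_lt with h | h
      · simpa [← h] using h0
      · simpa using (hd t 0 h le_rfl).continuousAt
    refine (Complex.reCLM.intervalIntegral_comp_comm hfint).symm.trans ?_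
    refine intervalIntegral.integral_congr fun t ht => ?_
    rw [Set.uIcc_of_le hR0.le] at ht
    have : Complex.I * x * t = ((x * t : ℝ) : ℂ) * Complex.I := by push_cast; ring
    simp only [hf, Complex.reCLM_apply]
    rw [whithamSymbolExt_ofReal ht.1, this, Complex.re_ofReal_mul,
      Complex.exp_ofReal_mul_I_re]
  have hre2 : (Complex.I * ∫ y in (0 : ℝ)..T, g y).re =
      ∫ s in (0 : ℝ)..T, whithamDensity s * Real.exp (-x * s) := by
    rw [Complex.I_mul_re]
    have := Complex.imCLM.intervalIntegral_comp_comm hgint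
    simp only [Complex.imCLM_apply] at this
    rw [← this, ← intervalIntegral.integral_neg]
    refine intervalIntegral.integral_congr fun s _ => ?_
    simp [hg, whithamSymbolBoundary, -Complex.ofReal_exp]
  have := (Complex.abs_re_le_norm _).trans key
  rwa [Complex.sub_re, hre1, hre2] at this

lemma tendsto_integral_whithamSymbol_mul_cos {x : ℝ} (hx : 0 < x) :
    Tendsto (fun R : ℝ => ∫ ξ in (0 : ℝ)..R, whithamSymbol ξ * Real.cos (x * ξ)) atTop
      (nhds (∫ s in Set.Ioi 0, whithamDensity s * Real.exp (-x * s))) := by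
  have hT : Tendsto (fun n : ℕ => (n : ℝ) * π) atTop atTop :=
    tendsto_natCast_atTop_atTop.atTop_mul_const Real.pi_pos
  rw [tendsto_iff_norm_sub_tendsto_zero]
  have hbound : Tendsto (fun R : ℝ => 2 / Real.sqrt R * x⁻¹) atTop (nhds 0) := by
    simpa using (tendsto_const_nhds.div_atTop Real.tendsto_sqrt_atTop).mul_const x⁻¹
  refine squeeze_zero' (Eventually.of_forall fun _ => norm_nonneg _) ?_ hbound
  filter_upwards [eventually_ge_atTop 1] with R hR
  have h1 : Tendsto (fun n : ℕ => Real.exp (-x * (n * π)) * R + 2 / Real.sqrt R * x⁻¹) atTop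
      (nhds (2 / Real.sqrt R * x⁻¹)) := by
    have := Real.tendsto_exp_atBot.comp (hT.const_mul_atTop_of_neg (neg_lt_zero.2 hx))
    simpa using (this.mul_const R).add_const (2 / Real.sqrt R * x⁻¹)
  have h2 := (tendsto_const_nhds (x := ∫ ξ in (0 : ℝ)..R, whithamSymbol ξ * Real.cos (x * ξ))).sub
    (intervalIntegral_tendsto_integral_Ioi 0 (integrableOn_whithamDensity_mul_exp hx) hT)
  refine le_of_tendsto_of_tendsto h2.norm h1 ?_
  filter_upwards [eventually_ne_atTop 0] with n hn
  exact abs_integral_whithamSymbol_mul_cos_sub_le hx hR hn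

lemma tendsto_integral_whithamSymbol_mul_cos_abs {x : ℝ} (hx : x ≠ 0) :
    Tendsto (fun R : ℝ => (1 / Real.pi) * ∫ ξ in (0:ℝ)..R, whithamSymbol ξ * Real.cos (x * ξ))
      atTop (nhds (1 / π * ∫ s in Set.Ioi 0, whithamDensity s * Real.exp (-|x| * s))) := by
  refine ((tendsto_integral_whithamSymbol_mul_cos (abs_pos.2 hx)).const_mul _).congr fun R => ?_
  congr 2 with ξ
  rcases abs_choice x with h | h <;> simp [h]

/-- The Whitham kernel is the Laplace transform of a nonnegative density. -/
lemma whithamKernel_eq {x : ℝ} (hx : x ≠ 0) :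
    whithamKernel x = 1 / π * ∫ s in Set.Ioi 0, whithamDensity s * Real.exp (-|x| * s) := by
  rw [whithamKernel, if_neg hx, (tendsto_integral_whithamSymbol_mul_cos_abs hx).limUnder_eq]

lemma whithamKernel_neg (x : ℝ) : whithamKernel (-x) = whithamKernel x := by
  simp [whithamKernel]

lemma integral_whithamKernel : ∫ x : ℝ, whithamKernel x = 1 := by
  have heven : ∀ x, whithamKernel |x| = whithamKernel x := fun x => by
    rcases abs_choice x with h | h <;> simp [h, whithamKernel_neg]
  have hinner : ∀ s : ℝ, 0 < s →
      ∫ x in Set.Ioi (0 : ℝ), whithamDensity s * Real.exp (-x * s) = whithamDensity s / s := by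
    intro s hs
    rw [integral_const_mul]
    have : ∀ x : ℝ, -x * s = -s * x := fun x => by ring
    simp_rw [this]
    rw [integral_exp_mul_Ioi (by linarith)]
    simp [div_eq_mul_inv]
  have hprod : Integrable (Function.uncurry fun x s : ℝ => whithamDensity s * Real.exp (-x * s))
      ((volume.restrict (Set.Ioi 0)).prod (volume.restrict (Set.Ioi 0))) := by
    refine (integrable_prod_iff' ?_).2 ⟨?_, ?_⟩
    · have := measurable_whithamDensity
      exact Measurable.aestronglyMeasurable (by unfold Function.uncurry; fun_prop)
    · refine (ae_restrict_iff' measurableSet_Ioi).2 (ae_of_all _ fun s (hs : 0 < s) => ?_)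
      have : ∀ x : ℝ, -x * s = -s * x := fun x => by ring
      simp only [Function.uncurry, this]
      exact (exp_neg_integrableOn_Ioi 0 hs).const_mul _
    · refine integrableOn_and_integral_whithamDensity_div.1.congr ?_
      refine (ae_restrict_iff' measurableSet_Ioi).2 (ae_of_all _ fun s (hs : 0 < s) => ?_)
      refine (hinner s hs).symm.trans ?_
      refine integral_congr_ae (ae_of_all _ fun x => ?_)
      exact (Real.norm_of_nonneg
        (mul_nonneg (whithamDensity_nonneg s) (Real.exp_pos _).le)).symm
  have hhalf : ∫ x in Set.Ioi (0 : ℝ), whithamKernel x = 1 / 2 := by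
    calc ∫ x in Set.Ioi (0 : ℝ), whithamKernel x
        = ∫ x in Set.Ioi (0 : ℝ), 1 / π * ∫ s in Set.Ioi (0 : ℝ),
            whithamDensity s * Real.exp (-x * s) :=
          setIntegral_congr_fun measurableSet_Ioi fun x (hx : 0 < x) => by
            simp only [whithamKernel_eq hx.ne', abs_of_pos hx]
      _ = 1 / π * ∫ s in Set.Ioi (0 : ℝ), whithamDensity s / s := by
          rw [integral_const_mul, integral_integral_swap hprod]
          congr 1
          exact setIntegral_congr_fun measurableSet_Ioi fun s hs => hinner s hs
      _ = 1 / 2 := by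
          rw [integrableOn_and_integral_whithamDensity_div.2]
          field_simp
  calc ∫ x : ℝ, whithamKernel x = ∫ x : ℝ, whithamKernel |x| := by simp_rw [heven]
    _ = 1 := by rw [integral_comp_abs, hhalf]; norm_num

/-- The measure on `(0, ∞)` whose Laplace transform is `π` times the Whitham kernel. -/
noncomputable def whithamMeasure : Measure ℝ :=
  (volume.restrict (Set.Ioi 0)).withDensity fun s => (Real.toNNReal (whithamDensity s) : ENNReal)

lemma mem_interior_integrableExpSet_whithamMeasure {x : ℝ} (hx : 0 < x) :
    x ∈ interior (ProbabilityTheory.integrableExpSet (fun s => -s) whithamMeasure) := by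
  refine interior_mono ?_ (by rwa [interior_Ioi] : x ∈ interior (Set.Ioi (0 : ℝ)))
  intro t ht
  refine (integrable_withDensity_iff_integrable_smul measurable_whithamDensity.real_toNNReal).2 ?_
  refine (integrableOn_whithamDensity_mul_exp ht).congr (ae_of_all _ fun s => ?_)
  simp [NNReal.smul_def, whithamDensity_nonneg]

lemma whithamKernel_eq_mgf {x : ℝ} (hx : 0 < x) :
    whithamKernel x = 1 / π * ProbabilityTheory.mgf (fun s => -s) whithamMeasure x := by
  rw [whithamKernel_eq hx.ne', abs_of_pos hx, ProbabilityTheory.mgf, whithamMeasure,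
    integral_withDensity_eq_integral_smul measurable_whithamDensity.real_toNNReal]
  simp [NNReal.smul_def, whithamDensity_nonneg]

lemma iteratedDeriv_whithamKernel (j : ℕ) {x : ℝ} (hx : 0 < x) :
    (-1) ^ j * iteratedDeriv j whithamKernel x =
      1 / π * ∫ s, s ^ j * Real.exp (-x * s) ∂whithamMeasure := by
  have hev : whithamKernel =ᶠ[nhds x]
      fun x => 1 / π * ProbabilityTheory.mgf (fun s => -s) whithamMeasure x := by
    filter_upwards [Ioi_mem_nhds hx] with y hy using whithamKernel_eq_mgf hy
  rw [hev.iteratedDeriv_eq, iteratedDeriv_const_mul_field,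
    ProbabilityTheory.iteratedDeriv_mgf (mem_interior_integrableExpSet_whithamMeasure hx),
    mul_left_comm, ← integral_const_mul]
  congr 2 with s
  rw [← mul_assoc, ← mul_pow]
  simp

lemma whithamKernel_completelyMonotone (j : ℕ) {x : ℝ} (hx : 0 < x) :
    0 < (-1 : ℝ) ^ j * iteratedDeriv j whithamKernel x := by
  rw [iteratedDeriv_whithamKernel j hx]
  refine mul_pos (by positivity) ?_
  have hint : Integrable (fun s => s ^ j * Real.exp (-x * s)) whithamMeasure := by
    refine ((ProbabilityTheory.integrable_pow_mul_exp_of_mem_interior_integrableExpSet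
      (mem_interior_integrableExpSet_whithamMeasure hx) j).const_mul ((-1) ^ j)).congr
      (ae_of_all _ fun s => ?_)
    beta_reduce
    rw [← mul_assoc, ← mul_pow]
    simp
  have hmeas := measurable_whithamDensity.real_toNNReal
  rw [whithamMeasure] at hint ⊢
  rw [integral_withDensity_eq_integral_smul hmeas]
  rw [integrable_withDensity_iff_integrable_smul hmeas] at hint
  rw [integral_pos_iff_support_of_nonneg_ae _ hint]
  · have hsub : Set.Ioo (π / 2) π ⊆ Function.support fun s =>
        Real.toNNReal (whithamDensity s) • (s ^ j * Real.exp (-x * s)) := by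
      intro s hs
      have h1 := whithamDensity_pos hs.1 hs.2
      have h2 : 0 < s := by linarith [hs.1, Real.pi_pos]
      rw [Function.mem_support, NNReal.smul_def, Real.coe_toNNReal _ h1.le, smul_eq_mul]
      positivity
    refine lt_of_lt_of_le ?_ (measure_mono hsub)
    rw [Measure.restrict_apply measurableSet_Ioo, Set.inter_eq_left.2 fun s hs => by
      exact Set.mem_Ioi.2 (by linarith [hs.1, Real.pi_pos])]
    simp [Real.pi_pos]
  · refine (ae_restrict_iff' measurableSet_Ioi).2 (ae_of_all _ fun s (hs : 0 < s) => ?_)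
    exact mul_nonneg (NNReal.coe_nonneg _) (by positivity)

theorem whitham_kernel_basic_properties :
    (∀ x : ℝ, x ≠ 0 →
      Tendsto (fun R : ℝ => (1 / Real.pi) * ∫ ξ in (0:ℝ)..R, whithamSymbol ξ * Real.cos (x * ξ))
        atTop (nhds (whithamKernel x))) ∧
    (∀ x : ℝ, whithamKernel (-x) = whithamKernel x) ∧
    (∀ j : ℕ, ∀ x : ℝ, 0 < x → 0 < (-1 : ℝ) ^ j * iteratedDeriv j whithamKernel x) ∧
    (∀ x : ℝ, 0 < x → 0 < whithamKernel x) ∧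
    StrictAntiOn whithamKernel (Set.Ioi 0) ∧
    ConvexOn ℝ (Set.Ioi 0) whithamKernel ∧
    Integrable whithamKernel ∧
    (∫ x : ℝ, whithamKernel x) = 1 := by
  have hderiv : ∀ x : ℝ, 0 < x → deriv whithamKernel x < 0 := fun x hx => by
    simpa using whithamKernel_completelyMonotone 1 hx
  have hderiv2 : ∀ x : ℝ, 0 < x → 0 < deriv (deriv whithamKernel) x := fun x hx => by
    simpa [iteratedDeriv_succ] using whithamKernel_completelyMonotone 2 hx
  have hdiff : ∀ x : ℝ, 0 < x → DifferentiableAt ℝ whithamKernel x := fun x hx =>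
    differentiableAt_of_deriv_ne_zero (hderiv x hx).ne
  have hcont : ContinuousOn whithamKernel (Set.Ioi 0) := fun x hx =>
    (hdiff x hx).continuousAt.continuousWithinAt
  refine ⟨fun x hx => ?_, whithamKernel_neg, fun j x hx => whithamKernel_completelyMonotone j hx,
    fun x hx => by simpa using whithamKernel_completelyMonotone 0 hx, ?_, ?_,
    integrable_of_integral_eq_one integral_whithamKernel, integral_whithamKernel⟩
  · rw [whithamKernel_eq hx]
    exact tendsto_integral_whithamSymbol_mul_cos_abs hx
  · exact strictAntiOn_of_deriv_neg (convex_Ioi 0) hcont fun x hx => by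
      rw [interior_Ioi] at hx
      exact hderiv x hx
  · refine convexOn_of_deriv2_nonneg (convex_Ioi 0) hcont ?_ ?_ ?_ <;> rw [interior_Ioi]
    · exact fun x hx => (hdiff x hx).differentiableWithinAt
    · exact fun x hx =>
        (differentiableAt_of_deriv_ne_zero (hderiv2 x hx).ne').differentiableWithinAt
    · exact fun x hx => (hderiv2 x hx).le
end

section
/- There exists a function K_reg : ℝ → ℝ that is infinitely differentiable on all of ℝ such that the Whitham kernel satisfies K(x) = 1/√(2π|x|) + K_reg(x) for every x ≠ 0. -/
open Real Filter MeasureTheory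

theorem hasDerivAt_sq_div_pow_four_add_one_primitive (s : ℝ) :
    HasDerivAt (fun s : ℝ ↦ (arctan (√2 * s + 1) + arctan (√2 * s - 1)) / (2 * √2)
      + (log (s ^ 2 - √2 * s + 1) - log (s ^ 2 + √2 * s + 1)) / (4 * √2))
      (s ^ 2 / (s ^ 4 + 1)) s := by
  have h2 : √2 ^ 2 = (2 : ℝ) := Real.sq_sqrt (by norm_num)
  have hm : 0 < s ^ 2 - √2 * s + 1 := by nlinarith [sq_nonneg (√2 * s - 1), sq_nonneg s]
  have hp : 0 < s ^ 2 + √2 * s + 1 := by nlinarith [sq_nonneg (√2 * s + 1), sq_nonneg s]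
  have hlin : HasDerivAt (fun s : ℝ ↦ √2 * s) √2 s := by
    simpa using (hasDerivAt_id s).const_mul √2
  have hsq : HasDerivAt (fun s : ℝ ↦ s ^ 2) (2 * s) s := by
    simpa using hasDerivAt_pow 2 s
  refine HasDerivAt.congr_deriv ((((hlin.add_const 1).arctan.add
    (hlin.sub_const 1).arctan).div_const (2 * √2)).add
    (((((hsq.sub hlin).add_const 1).log hm.ne').sub
      (((hsq.add hlin).add_const 1).log hp.ne')).div_const (4 * √2))) ?_
  have e1 : 1 + (√2 * s + 1) ^ 2 = 2 * (s ^ 2 + √2 * s + 1) := by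
    linear_combination s ^ 2 * h2
  have e2 : 1 + (√2 * s - 1) ^ 2 = 2 * (s ^ 2 - √2 * s + 1) := by
    linear_combination s ^ 2 * h2
  have e3 : s ^ 4 + 1 = (s ^ 2 - √2 * s + 1) * (s ^ 2 + √2 * s + 1) := by
    linear_combination s ^ 2 * h2
  simp only [Pi.add_apply, Pi.sub_apply]
  rw [e1, e2, e3]
  have hm' : s * (s - √2) + 1 ≠ 0 := by
    convert hm.ne' using 1
    ring
  have hp' : s * (s + √2) + 1 ≠ 0 := by
    convert hp.ne' using 1
    ring
  field_simp
  ring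

theorem integral_Ioi_sq_div_pow_four_add_one :
    ∫ s in Set.Ioi (0 : ℝ), s ^ 2 / (s ^ 4 + 1) = π / (2 * √2) := by
  have hlim : Tendsto (fun s : ℝ ↦ (arctan (√2 * s + 1) + arctan (√2 * s - 1)) / (2 * √2)
      + (log (s ^ 2 - √2 * s + 1) - log (s ^ 2 + √2 * s + 1)) / (4 * √2)) atTop
      (nhds ((π / 2 + π / 2) / (2 * √2) + 0 / (4 * √2))) := by
    have hlin : Tendsto (fun s : ℝ ↦ √2 * s) atTop atTop :=
      tendsto_id.const_mul_atTop (by positivity)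
    have harctan := tendsto_nhds_of_tendsto_nhdsWithin tendsto_arctan_atTop
    refine Tendsto.add (((harctan.comp (tendsto_atTop_add_const_right _ 1 hlin)).add
      (harctan.comp (tendsto_atTop_add_const_right _ (-1) hlin))).div_const _)
      (Tendsto.div_const ?_ _)
    have hinv : Tendsto (fun s : ℝ ↦ s⁻¹) atTop (nhds 0) := tendsto_inv_atTop_zero
    have hratio : Tendsto
        (fun s : ℝ ↦ log (1 - √2 * s⁻¹ + s⁻¹ ^ 2) - log (1 + √2 * s⁻¹ + s⁻¹ ^ 2))
        atTop (nhds (log (1 - √2 * 0 + 0 ^ 2) - log (1 + √2 * 0 + 0 ^ 2))) := by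
      refine Tendsto.sub (Tendsto.log ?_ (by norm_num)) (Tendsto.log ?_ (by norm_num))
      · exact (tendsto_const_nhds.sub (hinv.const_mul _)).add (hinv.pow 2)
      · exact (tendsto_const_nhds.add (hinv.const_mul _)).add (hinv.pow 2)
    simp only [mul_zero, sub_zero, add_zero, ne_eq, OfNat.ofNat_ne_zero, not_false_eq_true,
      zero_pow, log_one] at hratio
    refine hratio.congr' ?_
    filter_upwards [eventually_gt_atTop 0] with s hs
    have h2 : √2 ^ 2 = (2 : ℝ) := Real.sq_sqrt (by norm_num)
    have hm : 0 < s ^ 2 - √2 * s + 1 := by nlinarith [sq_nonneg (√2 * s - 1), sq_nonneg s]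
    have hp : 0 < s ^ 2 + √2 * s + 1 := by positivity
    have em : 1 - √2 * s⁻¹ + s⁻¹ ^ 2 = (s ^ 2 - √2 * s + 1) / s ^ 2 := by field_simp
    have ep : 1 + √2 * s⁻¹ + s⁻¹ ^ 2 = (s ^ 2 + √2 * s + 1) / s ^ 2 := by field_simp
    rw [em, ep, log_div hm.ne' (by positivity), log_div hp.ne' (by positivity)]
    ring
  rw [integral_Ioi_of_hasDerivAt_of_nonneg'
    (fun s _ ↦ hasDerivAt_sq_div_pow_four_add_one_primitive s) (fun s _ ↦ by positivity) hlim]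
  simp [arctan_neg]

theorem integral_exp_neg_mul_mul_cos (a R : ℝ) :
    ∫ ξ in (0 : ℝ)..R, rexp (-(a * ξ)) * cos ξ =
      (a + rexp (-(a * R)) * (sin R - a * cos R)) / (a ^ 2 + 1) := by
  have ha : a ^ 2 + 1 ≠ 0 := by positivity
  have hderiv : ∀ ξ : ℝ, HasDerivAt
      (fun ξ ↦ rexp (-(a * ξ)) * (sin ξ - a * cos ξ) / (a ^ 2 + 1))
      (rexp (-(a * ξ)) * cos ξ) ξ := by
    intro ξ
    have hlin : HasDerivAt (fun ξ : ℝ ↦ -(a * ξ)) (-a) ξ := by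
      simpa using (hasDerivAt_id ξ).const_mul (-a)
    refine HasDerivAt.congr_deriv ((hlin.exp.mul ((hasDerivAt_sin ξ).sub
      ((hasDerivAt_cos ξ).const_mul a))).div_const (a ^ 2 + 1)) ?_
    simp only [Pi.sub_apply]
    field_simp
    ring
  rw [intervalIntegral.integral_eq_sub_of_hasDerivAt (fun ξ _ ↦ hderiv ξ)
    ((by fun_prop : Continuous fun ξ ↦ rexp (-(a * ξ)) * cos ξ).intervalIntegrable _ _)]
  simp
  ring

theorem integral_Ioi_exp_neg_sq_mul (ξ : ℝ) :
    ∫ s in Set.Ioi (0 : ℝ), rexp (-(s ^ 2 * ξ)) = √π / 2 * (√ξ)⁻¹ := by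
  have h := integral_gaussian_Ioi ξ
  rw [sqrt_div pi_pos.le] at h
  rw [div_mul_eq_mul_div, ← div_eq_mul_inv, ← h]
  congr 1 with s
  ring_nf

theorem intervalIntegrable_inv_sqrt (a b : ℝ) :
    IntervalIntegrable (fun ξ : ℝ ↦ (√ξ)⁻¹) volume a b := by
  convert intervalIntegral.intervalIntegrable_rpow' (a := a) (b := b) (r := -(1 / 2))
    (by norm_num) using 2 with ξ
  rcases le_or_gt 0 ξ with hξ | hξ
  · rw [sqrt_eq_rpow, rpow_neg hξ]
  · rw [sqrt_eq_zero_of_nonpos hξ.le, rpow_def_of_neg hξ, neg_mul, cos_neg, one_div_mul_eq_div,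
      cos_pi_div_two, mul_zero, inv_zero]

theorem integral_inv_sqrt_mul_cos {R : ℝ} (hR : 0 ≤ R) :
    ∫ ξ in (0 : ℝ)..R, (√ξ)⁻¹ * cos ξ = 2 / √π * ∫ s in Set.Ioi (0 : ℝ),
      (s ^ 2 + rexp (-(s ^ 2 * R)) * (sin R - s ^ 2 * cos R)) / (s ^ 4 + 1) := by
  have hint : Integrable (Function.uncurry fun ξ s : ℝ ↦ rexp (-(s ^ 2 * ξ)) * cos ξ)
      ((volume.restrict (Set.uIoc 0 R)).prod (volume.restrict (Set.Ioi 0))) := by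
    rw [Set.uIoc_of_le hR, integrable_prod_iff
      (by simp only [Function.uncurry_def]; fun_prop)]
    constructor
    · filter_upwards [ae_restrict_mem measurableSet_Ioc] with ξ hξ
      have h := ((integrable_exp_neg_mul_sq hξ.1).restrict (s := Set.Ioi 0)).mul_const (cos ξ)
      refine h.congr (.of_forall fun s ↦ ?_)
      simp only [Function.uncurry_apply_pair]
      ring_nf
    · have h := ((intervalIntegrable_inv_sqrt 0 R).mul_continuousOn
        (g := fun ξ ↦ |cos ξ| * (√π / 2)) (by fun_prop))
      rw [intervalIntegrable_iff_integrableOn_Ioc_of_le hR] at h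
      refine Integrable.congr h ?_
      filter_upwards [ae_restrict_mem measurableSet_Ioc] with ξ hξ
      simp only [Function.uncurry_apply_pair, norm_mul, Real.norm_eq_abs, abs_exp]
      rw [integral_mul_const, integral_Ioi_exp_neg_sq_mul]
      ring
  have hswap := intervalIntegral_integral_swap hint
  have hleft : ∫ ξ in (0 : ℝ)..R, ∫ s in Set.Ioi (0 : ℝ), rexp (-(s ^ 2 * ξ)) * cos ξ =
      √π / 2 * ∫ ξ in (0 : ℝ)..R, (√ξ)⁻¹ * cos ξ := by
    rw [← intervalIntegral.integral_const_mul, intervalIntegral.integral_of_le hR,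
      intervalIntegral.integral_of_le hR]
    refine setIntegral_congr_fun measurableSet_Ioc fun ξ hξ ↦ ?_
    rw [integral_mul_const, integral_Ioi_exp_neg_sq_mul, mul_assoc]
  simp_rw [integral_exp_neg_mul_mul_cos, ← pow_mul] at hswap
  rw [hleft] at hswap
  have hπ : 0 < √π := by positivity
  rw [← hswap]
  field_simp

/-- The Fresnel integral `∫₀^∞ ξ^(-1/2) cos ξ dξ = √(π/2)`. -/
theorem tendsto_integral_inv_sqrt_mul_cos :
    Tendsto (fun R : ℝ ↦ ∫ ξ in (0 : ℝ)..R, (√ξ)⁻¹ * cos ξ) atTop (nhds (√π / √2)) := by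
  have hlim : Tendsto (fun R : ℝ ↦ ∫ s in Set.Ioi (0 : ℝ),
      (s ^ 2 + rexp (-(s ^ 2 * R)) * (sin R - s ^ 2 * cos R)) / (s ^ 4 + 1)) atTop
      (nhds (∫ s in Set.Ioi (0 : ℝ), s ^ 2 / (s ^ 4 + 1))) := by
    refine tendsto_integral_filter_of_dominated_convergence (fun s ↦ 4 * (1 + s ^ 2)⁻¹)
      (.of_forall fun R ↦ ?_) ?_ (integrable_inv_one_add_sq.const_mul 4).restrict ?_
    · exact (Continuous.div (by fun_prop) (by fun_prop)
        fun s ↦ by positivity).aestronglyMeasurable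
    · filter_upwards [eventually_ge_atTop 0] with R hR
      refine .of_forall fun s ↦ ?_
      have hexp : rexp (-(s ^ 2 * R)) ≤ 1 := exp_le_one_iff.2 (by simp; positivity)
      have htrig : |sin R - s ^ 2 * cos R| ≤ 1 + s ^ 2 := by
        refine (abs_sub _ _).trans (add_le_add (abs_sin_le_one R) ?_)
        rw [abs_mul, abs_of_nonneg (sq_nonneg s)]
        exact mul_le_of_le_one_right (sq_nonneg s) (abs_cos_le_one R)
      have hprod : |rexp (-(s ^ 2 * R)) * (sin R - s ^ 2 * cos R)| ≤ 1 + s ^ 2 := by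
        rw [abs_mul, abs_exp]
        exact (mul_le_of_le_one_left (abs_nonneg _) hexp).trans htrig
      have hnum : |s ^ 2 + rexp (-(s ^ 2 * R)) * (sin R - s ^ 2 * cos R)| ≤ 2 * s ^ 2 + 1 := by
        refine (abs_add_le _ _).trans ?_
        rw [abs_of_nonneg (sq_nonneg s)]
        linarith
      rw [Real.norm_eq_abs, abs_div, abs_of_pos (by positivity : 0 < s ^ 4 + 1),
        ← div_eq_mul_inv, div_le_div_iff₀ (by positivity) (by positivity)]
      nlinarith [sq_nonneg (s ^ 2 - 1), sq_nonneg s]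
    · filter_upwards [ae_restrict_mem measurableSet_Ioi] with s hs
      have hs : 0 < s := hs
      refine Tendsto.div_const ?_ _
      have hz : Tendsto (fun R : ℝ ↦ rexp (-(s ^ 2 * R)) * (sin R - s ^ 2 * cos R)) atTop
          (nhds 0) := by
        refine Tendsto.zero_mul_isBoundedUnder_le ?_ ⟨1 + s ^ 2, ?_⟩
        · exact tendsto_exp_neg_atTop_nhds_zero.comp
            (tendsto_id.const_mul_atTop (by positivity : 0 < s ^ 2))
        · refine eventually_map.2 (.of_forall fun R ↦ ?_)
          refine (abs_sub _ _).trans (add_le_add (abs_sin_le_one R) ?_)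
          rw [abs_mul, abs_of_nonneg (sq_nonneg s)]
          exact mul_le_of_le_one_right (sq_nonneg s) (abs_cos_le_one R)
      simpa using hz.const_add (s ^ 2)
  rw [integral_Ioi_sq_div_pow_four_add_one] at hlim
  have hval : √π / √2 = 2 / √π * (π / (2 * √2)) := by
    have hπ : 0 < √π := by positivity
    have := Real.sq_sqrt pi_pos.le
    field_simp
    linarith
  rw [hval]
  refine (hlim.const_mul (2 / √π)).congr' ?_
  filter_upwards [eventually_ge_atTop 0] with R hR using (integral_inv_sqrt_mul_cos hR).symm

theorem tendsto_integral_inv_sqrt_mul_cos_mul {x : ℝ} (hx : x ≠ 0) :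
    Tendsto (fun R : ℝ ↦ ∫ ξ in (0 : ℝ)..R, (√ξ)⁻¹ * cos (x * ξ)) atTop
      (nhds (√π / √(2 * |x|))) := by
  have hx' : 0 < |x| := abs_pos.2 hx
  have hs : 0 < √|x| := by positivity
  have h := ((tendsto_integral_inv_sqrt_mul_cos.comp
    (tendsto_id.const_mul_atTop hx')).const_mul (√|x|)⁻¹)
  rw [sqrt_mul zero_le_two, ← div_div, div_eq_inv_mul _ (√|x|)]
  refine h.congr fun R ↦ ?_
  have hsub := intervalIntegral.integral_comp_mul_left (a := 0) (b := R)
    (fun u ↦ (√u)⁻¹ * cos u) hx'.ne'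
  have hcos : ∀ ξ, cos (|x| * ξ) = cos (x * ξ) := by
    intro ξ
    rcases abs_choice x with hc | hc <;> rw [hc]
    rw [neg_mul, cos_neg]
  simp only [hcos, sqrt_mul hx'.le, mul_inv, mul_zero, mul_assoc,
    intervalIntegral.integral_const_mul, smul_eq_mul] at hsub
  simp only [Function.comp_apply, id]
  have := Real.sq_sqrt hx'.le
  field_simp at hsub ⊢
  refine mul_left_cancel₀ hs.ne' ?_
  rw [← mul_assoc, ← pow_two, this]
  linarith

/-- The Whitham symbol minus its leading part `ξ^(-1/2)` at infinity. -/
noncomputable def whithamRemainder (ξ : ℝ) : ℝ :=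
  whithamSymbol ξ - (√ξ)⁻¹

theorem measurable_whithamRemainder : Measurable whithamRemainder := by
  have htanh : Measurable Real.tanh := by
    have : Real.tanh = fun x ↦ sinh x / cosh x := funext tanh_eq_sinh_div_cosh
    rw [this]
    fun_prop
  unfold whithamRemainder whithamSymbol
  refine Measurable.sub ?_ (by fun_prop)
  exact Measurable.ite (measurableSet_singleton 0) measurable_const (by fun_prop)

theorem abs_whithamRemainder_le {ξ : ℝ} (hξ : 0 < ξ) :
    |whithamRemainder ξ| ≤ 2 * (rexp (-ξ) * (√ξ)⁻¹) := by
  have hsqrt : 0 < √ξ := by positivity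
  have hlt := tanh_lt_one ξ
  have hnonneg : 0 ≤ tanh ξ := by
    rw [tanh_eq_sinh_div_cosh]
    exact div_nonneg (sinh_nonneg_iff.2 hξ.le) (cosh_pos ξ).le
  have hself : tanh ξ ≤ √(tanh ξ) := by
    apply Real.le_sqrt_of_sq_le
    nlinarith
  have hle : √(tanh ξ) ≤ 1 := Real.sqrt_le_one.2 hlt.le
  have htail : 1 - tanh ξ ≤ 2 * rexp (-ξ) := by
    have h1 : 1 ≤ rexp ξ := one_le_exp hξ.le
    have h2 := exp_pos (-ξ)
    rw [tanh_eq]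
    have : 1 - (rexp ξ - rexp (-ξ)) / (rexp ξ + rexp (-ξ)) =
        2 * rexp (-ξ) / (rexp ξ + rexp (-ξ)) := by
      field_simp
      ring
    rw [this]
    exact div_le_self (by positivity) (by linarith)
  have heq : whithamRemainder ξ = -((1 - √(tanh ξ)) * (√ξ)⁻¹) := by
    rw [whithamRemainder, whithamSymbol, if_neg hξ.ne', sqrt_div hnonneg]
    ring
  rw [heq, abs_neg, abs_of_nonneg (mul_nonneg (by linarith) (by positivity)), ← mul_assoc]
  gcongr
  linarith

theorem integrableOn_pow_mul_whithamRemainder (n : ℕ) :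
    IntegrableOn (fun ξ ↦ ξ ^ n * whithamRemainder ξ) (Set.Ioi 0) := by
  have hgamma := (GammaIntegral_convergent (s := n + 1 / 2) (by positivity)).const_mul 2
  refine Integrable.mono' hgamma
    ((measurable_id.pow_const n).mul measurable_whithamRemainder).aestronglyMeasurable ?_
  filter_upwards [ae_restrict_mem measurableSet_Ioi] with ξ hξ
  have hξ : 0 < ξ := hξ
  have hpow : ξ ^ ((n : ℝ) + 1 / 2 - 1) = ξ ^ n * (√ξ)⁻¹ := by
    rw [sqrt_eq_rpow, ← rpow_neg hξ.le, ← rpow_natCast, ← rpow_add hξ]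
    ring_nf
  rw [norm_mul, norm_pow, Real.norm_eq_abs, Real.norm_eq_abs, abs_of_pos hξ, hpow]
  calc ξ ^ n * |whithamRemainder ξ| ≤ ξ ^ n * (2 * (rexp (-ξ) * (√ξ)⁻¹)) := by
        gcongr
        exact abs_whithamRemainder_le hξ
    _ = _ := by ring

theorem integrableOn_whithamRemainder : IntegrableOn whithamRemainder (Set.Ioi 0) := by
  simpa using integrableOn_pow_mul_whithamRemainder 0

theorem integrableOn_whithamRemainder_mul_cos (x : ℝ) :
    IntegrableOn (fun ξ ↦ whithamRemainder ξ * cos (x * ξ)) (Set.Ioi 0) :=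
  integrableOn_whithamRemainder.mul_bdd (c := 1) (by fun_prop)
    (.of_forall fun ξ ↦ abs_cos_le_one _)

/-- A cosine transform on the half-line is smooth when all moments of the function are finite. -/
theorem contDiff_integral_Ioi_mul_cos {f : ℝ → ℝ}
    (hf : ∀ n : ℕ, IntegrableOn (fun ξ ↦ ξ ^ n * f ξ) (Set.Ioi 0)) :
    ContDiff ℝ (⊤ : ℕ∞) fun x ↦ ∫ ξ in Set.Ioi (0 : ℝ), f ξ * cos (x * ξ) := by
  set g : ℝ → ℂ := (Set.Ioi (0 : ℝ)).indicator fun ξ ↦ (f ξ : ℂ) with hg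
  have hmoments : ∀ n : ℕ, (n : ℕ∞) ≤ ⊤ → Integrable fun ξ : ℝ ↦ ‖ξ‖ ^ n * ‖g ξ‖ := by
    intro n _
    refine ((hf n).integrable_indicator measurableSet_Ioi).norm.congr (.of_forall fun ξ ↦ ?_)
    by_cases hξ : ξ ∈ Set.Ioi (0 : ℝ) <;> simp [hg, hξ]
  have hf0 : IntegrableOn f (Set.Ioi 0) := by simpa using hf 0
  have hsmooth : ContDiff ℝ (⊤ : ℕ∞) fun x : ℝ ↦
      (FourierTransform.fourier g (x / (2 * π))).re :=
    Complex.reCLM.contDiff.comp ((contDiff_fourier hmoments).comp (contDiff_id.div_const _))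
  convert hsmooth using 2 with x
  have hgi : IntegrableOn (fun ξ : ℝ ↦
      Complex.exp (↑(-2 * π * ξ * (x / (2 * π))) * Complex.I) • (f ξ : ℂ)) (Set.Ioi 0) := by
    refine hf0.ofReal.bdd_mul (c := 1) (by fun_prop) (.of_forall fun ξ ↦ ?_)
    rw [Complex.norm_exp_ofReal_mul_I]
  have hind : (fun ξ : ℝ ↦ Complex.exp (↑(-2 * π * ξ * (x / (2 * π))) * Complex.I) • g ξ) =
      (Set.Ioi 0).indicator fun ξ : ℝ ↦
        Complex.exp (↑(-2 * π * ξ * (x / (2 * π))) * Complex.I) • (f ξ : ℂ) := by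
    ext ξ
    by_cases hξ : ξ ∈ Set.Ioi (0 : ℝ) <;> simp [hg, hξ]
  rw [fourier_real_eq_integral_exp_smul, hind, integral_indicator measurableSet_Ioi]
  have hre := integral_re hgi
  simp only [RCLike.re_eq_complex_re] at hre
  rw [← hre]
  congr 1 with ξ
  have harg : -2 * π * ξ * (x / (2 * π)) = -(x * ξ) := by field_simp
  rw [smul_eq_mul, Complex.re_mul_ofReal, Complex.exp_ofReal_mul_I_re, harg, cos_neg, mul_comm]

theorem whitham_kernel_singular_part :
    ∃ Kreg : ℝ → ℝ, ContDiff ℝ (⊤ : ℕ∞) Kreg ∧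
      ∀ x : ℝ, x ≠ 0 →
        whithamKernel x = 1 / Real.sqrt (2 * Real.pi * |x|) + Kreg x := by
  refine ⟨fun x ↦ 1 / π * ∫ ξ in Set.Ioi (0 : ℝ), whithamRemainder ξ * cos (x * ξ),
    contDiff_const.mul (contDiff_integral_Ioi_mul_cos integrableOn_pow_mul_whithamRemainder),
    fun x hx ↦ ?_⟩
  rw [whithamKernel, if_neg hx]
  have hx' : 0 < |x| := abs_pos.2 hx
  have hconst : 1 / √(2 * π * |x|) = 1 / π * (√π / √(2 * |x|)) := by
    rw [show 2 * π * |x| = π * (2 * |x|) by ring, sqrt_mul pi_pos.le]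
    have hπ : 0 < √π := by positivity
    have hs := Real.sq_sqrt pi_pos.le
    field_simp
    exact hs.symm
  rw [hconst, ← mul_add]
  refine Tendsto.limUnder_eq (Tendsto.const_mul _ ?_)
  refine ((tendsto_integral_inv_sqrt_mul_cos_mul hx).add
    (intervalIntegral_tendsto_integral_Ioi 0 (integrableOn_whithamRemainder_mul_cos x)
      tendsto_id)).congr' ?_
  filter_upwards [eventually_ge_atTop 0] with R hR
  have hrem : IntervalIntegrable (fun ξ ↦ whithamRemainder ξ * cos (x * ξ)) volume 0 R :=
    (intervalIntegrable_iff_integrableOn_Ioc_of_le hR).2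
      ((integrableOn_whithamRemainder_mul_cos x).mono_set Set.Ioc_subset_Ioi_self)
  rw [id, ← intervalIntegral.integral_add
    ((intervalIntegrable_inv_sqrt 0 R).mul_continuousOn (by fun_prop)) hrem]
  congr 1 with ξ
  rw [whithamRemainder]
  ring
end

section
/- The Whitham symbol m is a classical symbol of order −1/2: m is infinitely differentiable on ℝ, and for every n ∈ ℕ there exists a constant C_n > 0 such that |m^{(n)}(ξ)| ≤ C_n·(1 + |ξ|)^{−1/2−n} for all ξ ∈ ℝ, where m^{(n)} denotes the n-th iterated derivative of m. -/
open Real Filter MeasureTheory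

open scoped Topology ContDiff

theorem hasDerivAt_real_tanh (x : ℝ) : HasDerivAt Real.tanh (1 - Real.tanh x ^ 2) x := by
  have hc : Real.cosh x ≠ 0 := (Real.cosh_pos x).ne'
  have h := (Real.hasDerivAt_sinh x).div (Real.hasDerivAt_cosh x) hc
  have he : Real.tanh = Real.sinh / Real.cosh := funext Real.tanh_eq_sinh_div_cosh
  rw [he]
  refine h.congr_deriv ?_
  simp only [Pi.div_apply]
  field_simp

theorem analyticAt_real_tanh (x : ℝ) : AnalyticAt ℝ Real.tanh x := by
  have he : Real.tanh = Real.sinh / Real.cosh := funext Real.tanh_eq_sinh_div_cosh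
  rw [he]
  exact Real.analyticAt_sinh.div Real.analyticAt_cosh (Real.cosh_pos x).ne'

theorem strictMono_real_tanh : StrictMono Real.tanh := by
  refine strictMono_of_deriv_pos fun x => ?_
  rw [(hasDerivAt_real_tanh x).deriv]
  linarith [Real.tanh_sq_lt_one x]

theorem real_tanh_pos {x : ℝ} (hx : 0 < x) : 0 < Real.tanh x := by
  simpa using strictMono_real_tanh hx

theorem one_sub_tanh_sq_le_mul_rpow (n : ℕ) :
    ∃ C : ℝ, 0 ≤ C ∧ ∀ x : ℝ, 0 < x → 1 - Real.tanh x ^ 2 ≤ C * x ^ (-(n : ℝ)) := by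
  refine ⟨2 * n.factorial, by positivity, fun x hx => ?_⟩
  have hc := Real.cosh_pos x
  have h1 : 1 - Real.tanh x ^ 2 = (Real.cosh x ^ 2)⁻¹ := by
    rw [Real.tanh_eq_sinh_div_cosh, div_pow, Real.sinh_sq]
    field_simp
    ring
  have h2 : Real.exp x / 2 ≤ Real.cosh x ^ 2 := by
    have := Real.one_le_cosh x
    have := Real.exp_pos (-x)
    have := Real.cosh_eq x
    nlinarith
  have h3 : x ^ n ≤ n.factorial * Real.exp x := by
    have := Real.pow_div_factorial_le_exp x hx.le n
    rwa [div_le_iff₀' (by positivity)] at this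
  rw [h1, Real.rpow_neg hx.le, Real.rpow_natCast, ← div_eq_mul_inv, inv_le_comm₀ (by positivity)
    (by positivity), inv_div, div_le_iff₀ (by positivity)]
  calc x ^ n ≤ n.factorial * Real.exp x := h3
    _ = Real.exp x / 2 * (2 * n.factorial) := by ring
    _ ≤ _ := by gcongr

theorem exists_iteratedDeriv_comp_tanh {F : ℝ → ℝ} (hF : ContDiffOn ℝ ∞ F (Set.Ioi 0)) (n : ℕ) :
    ∃ G : ℝ → ℝ, ContDiffOn ℝ ∞ G (Set.Ioi 0) ∧
      ∀ x, 0 < x → iteratedDeriv n (F ∘ Real.tanh) x = G (Real.tanh x) := by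
  induction n with
  | zero => exact ⟨F, hF, fun x _ => by simp⟩
  | succ n ih =>
    obtain ⟨G, hG, h⟩ := ih
    have hG' := (contDiffOn_infty_iff_deriv_of_isOpen isOpen_Ioi).1 hG
    refine ⟨fun t => deriv G t * (1 - t ^ 2), hG'.2.mul (by fun_prop), fun x hx => ?_⟩
    have he : iteratedDeriv n (F ∘ Real.tanh) =ᶠ[𝓝 x] G ∘ Real.tanh := by
      filter_upwards [isOpen_Ioi.mem_nhds hx] with y hy using h y hy
    rw [iteratedDeriv_succ, he.deriv_eq]
    have hd := (hG'.1.differentiableAt (isOpen_Ioi.mem_nhds (real_tanh_pos hx))).hasDerivAt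
    exact (hd.comp x (hasDerivAt_real_tanh x)).deriv

theorem iteratedDeriv_comp_tanh_bound {F : ℝ → ℝ} (hF : ContDiffOn ℝ ∞ F (Set.Ioi 0)) (n : ℕ) :
    ∃ C : ℝ, 0 ≤ C ∧
      ∀ x, 1 ≤ x → |iteratedDeriv n (F ∘ Real.tanh) x| ≤ C * x ^ (-(n : ℝ)) := by
  have ht : ∀ x, 1 ≤ x → Real.tanh x ∈ Set.Icc (Real.tanh 1) 1 := fun x hx =>
    ⟨strictMono_real_tanh.monotone hx, (Real.tanh_lt_one x).le⟩
  have hsub : Set.Icc (Real.tanh 1) 1 ⊆ Set.Ioi 0 := fun t h =>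
    (real_tanh_pos one_pos).trans_le h.1
  have hbdd : ∀ G : ℝ → ℝ, ContDiffOn ℝ ∞ G (Set.Ioi 0) →
      ∃ B : ℝ, 0 ≤ B ∧ ∀ x, 1 ≤ x → |G (Real.tanh x)| ≤ B := fun G hG => by
    obtain ⟨B, hB⟩ := isCompact_Icc.exists_bound_of_continuousOn (hG.continuousOn.mono hsub)
    exact ⟨B, (norm_nonneg _).trans (hB _ (ht 1 le_rfl)), fun x hx => hB _ (ht x hx)⟩
  cases n with
  | zero =>
    obtain ⟨B, hB0, hB⟩ := hbdd F hF
    exact ⟨B, hB0, fun x hx => by simpa using hB x hx⟩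
  | succ n =>
    obtain ⟨G, hG, h⟩ := exists_iteratedDeriv_comp_tanh hF n
    have hG' := (contDiffOn_infty_iff_deriv_of_isOpen isOpen_Ioi).1 hG
    obtain ⟨B, hB0, hB⟩ := hbdd _ hG'.2
    obtain ⟨D, hD0, hD⟩ := one_sub_tanh_sq_le_mul_rpow (n + 1)
    refine ⟨B * D, mul_nonneg hB0 hD0, fun x hx => ?_⟩
    have hx0 : 0 < x := one_pos.trans_le hx
    have he : iteratedDeriv n (F ∘ Real.tanh) =ᶠ[𝓝 x] G ∘ Real.tanh := by
      filter_upwards [isOpen_Ioi.mem_nhds hx0] with y hy using h y hy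
    have hd := (hG'.1.differentiableAt (isOpen_Ioi.mem_nhds (real_tanh_pos hx0))).hasDerivAt
    rw [iteratedDeriv_succ, he.deriv_eq, (hd.comp x (hasDerivAt_real_tanh x)).deriv, abs_mul,
      abs_of_nonneg (sub_nonneg.2 (Real.tanh_sq_lt_one x).le), mul_assoc]
    exact mul_le_mul (hB x hx) (hD x hx0) (sub_nonneg.2 (Real.tanh_sq_lt_one x).le) hB0

theorem whithamSymbol_eq_sqrt_dslope (x : ℝ) :
    whithamSymbol x = Real.sqrt (dslope Real.tanh 0 x) := by
  unfold whithamSymbol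
  split_ifs with h
  · simp [h, (hasDerivAt_real_tanh 0).deriv]
  · rw [dslope_of_ne _ h, slope_def_field]
    simp

theorem dslope_tanh_pos (x : ℝ) : 0 < dslope Real.tanh 0 x := by
  rcases eq_or_ne x 0 with rfl | h
  · simp [(hasDerivAt_real_tanh 0).deriv]
  · rw [dslope_of_ne _ h]
    rw [slope_def_field, Real.tanh_zero, sub_zero, sub_zero]
    rcases h.lt_or_gt with h | h
    · exact div_pos_of_neg_of_neg (by simpa using strictMono_real_tanh h) h
    · exact div_pos (real_tanh_pos h) h

theorem analyticAt_dslope_tanh (x : ℝ) : AnalyticAt ℝ (dslope Real.tanh 0) x := by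
  rcases eq_or_ne x 0 with rfl | h
  · obtain ⟨p, hp⟩ := analyticAt_real_tanh 0
    exact hp.has_fpower_series_dslope_fslope.analyticAt
  · have h1 : AnalyticAt ℝ (fun y => Real.tanh y / y) x :=
      (analyticAt_real_tanh x).div analyticAt_id h
    refine h1.congr ?_
    filter_upwards [isOpen_ne.mem_nhds h] with y hy
    rw [dslope_of_ne _ hy, slope_def_field]
    simp

theorem contDiff_whithamSymbol : ContDiff ℝ ∞ whithamSymbol := by
  rw [funext whithamSymbol_eq_sqrt_dslope]
  exact contDiff_iff_contDiffAt.2 fun x =>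
    (analyticAt_dslope_tanh x).contDiffAt.sqrt (dslope_tanh_pos x).ne'

theorem whithamSymbol_neg (x : ℝ) : whithamSymbol (-x) = whithamSymbol x := by
  simp [whithamSymbol, Real.tanh_neg]

theorem abs_iteratedDeriv_whithamSymbol_neg (n : ℕ) (x : ℝ) :
    |iteratedDeriv n whithamSymbol (-x)| = |iteratedDeriv n whithamSymbol x| := by
  have h := iteratedDeriv_comp_neg n whithamSymbol x
  rw [funext whithamSymbol_neg] at h
  simp [h, abs_mul]

theorem whithamSymbol_eq_mul_rpow {x : ℝ} (hx : 0 < x) :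
    whithamSymbol x = (Real.sqrt ∘ Real.tanh) x * x ^ (-(1 / 2) : ℝ) := by
  rw [whithamSymbol, if_neg hx.ne', Real.sqrt_div' _ hx.le, Real.rpow_neg hx.le,
    ← Real.sqrt_eq_rpow, div_eq_mul_inv, Function.comp_apply]

theorem iteratedDeriv_whithamSymbol_bound_of_one_le (n : ℕ) :
    ∃ C : ℝ, 0 ≤ C ∧
      ∀ x, 1 ≤ x → |iteratedDeriv n whithamSymbol x| ≤ C * x ^ (-(1 / 2 : ℝ) - n) := by
  have hsqrt : ContDiffOn ℝ ∞ Real.sqrt (Set.Ioi 0) := fun x hx =>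
    (Real.contDiffAt_sqrt (ne_of_gt hx)).contDiffWithinAt
  choose A hA0 hA using iteratedDeriv_comp_tanh_bound hsqrt
  set B : ℕ → ℝ := fun k => |(descPochhammer ℝ k).eval (-(1 / 2) : ℝ)|
  refine ⟨∑ i ∈ Finset.range (n + 1), n.choose i * A i * B (n - i),
    Finset.sum_nonneg fun i _ => by have := hA0 i; positivity, fun x hx => ?_⟩
  have hx0 : 0 < x := one_pos.trans_le hx
  have he : whithamSymbol =ᶠ[𝓝 x] (Real.sqrt ∘ Real.tanh) * fun y => y ^ (-(1 / 2) : ℝ) := by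
    filter_upwards [isOpen_Ioi.mem_nhds hx0] with y hy using whithamSymbol_eq_mul_rpow hy
  have hs : ContDiffAt ℝ n (Real.sqrt ∘ Real.tanh) x :=
    (Real.contDiffAt_sqrt (real_tanh_pos hx0).ne').comp x (analyticAt_real_tanh x).contDiffAt
  rw [he.iteratedDeriv_eq, iteratedDeriv_mul hs (Real.contDiffAt_rpow_const_of_ne hx0.ne'),
    Finset.sum_mul]
  refine (Finset.abs_sum_le_sum_abs _ _).trans (Finset.sum_le_sum fun i hi => ?_)
  have hin : i ≤ n := Nat.lt_succ_iff.1 (Finset.mem_range.1 hi)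
  rw [abs_mul, abs_mul, Nat.abs_cast, iteratedDeriv_eq_iterate (n := n - i),
    Real.iter_deriv_rpow_const, abs_mul, abs_of_pos (Real.rpow_pos_of_pos hx0 _)]
  calc (n.choose i : ℝ) * |iteratedDeriv i (Real.sqrt ∘ Real.tanh) x| *
        (B (n - i) * x ^ (-(1 / 2) - ((n - i : ℕ) : ℝ)))
      ≤ n.choose i * (A i * x ^ (-(i : ℝ))) * (B (n - i) * x ^ (-(1 / 2) - ((n - i : ℕ) : ℝ))) := by
        gcongr
        exact hA i x hx
    _ = n.choose i * A i * B (n - i) *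
        (x ^ (-(i : ℝ)) * x ^ (-(1 / 2) - ((n - i : ℕ) : ℝ))) := by ring
    _ = _ := by
        rw [← Real.rpow_add hx0, Nat.cast_sub hin]
        ring_nf

theorem whitham_symbol_is_classical_symbol :
    ContDiff ℝ (⊤ : ℕ∞) whithamSymbol ∧
    ∀ n : ℕ, ∃ C : ℝ, 0 < C ∧ ∀ ξ : ℝ,
      |iteratedDeriv n whithamSymbol ξ| ≤ C * (1 + |ξ|) ^ (-(1 / 2 : ℝ) - n) := by
  refine ⟨contDiff_whithamSymbol, fun n => ?_⟩
  set s : ℝ := -(1 / 2 : ℝ) - n with hs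
  have hs0 : s ≤ 0 := by
    have : (0 : ℝ) ≤ n := n.cast_nonneg
    linarith
  have hcont : Continuous (iteratedDeriv n whithamSymbol) :=
    contDiff_whithamSymbol.continuous_iteratedDeriv n (by exact_mod_cast le_top)
  obtain ⟨K, hK⟩ := (isCompact_Icc (a := (0 : ℝ)) (b := 1)).exists_bound_of_continuousOn
    hcont.continuousOn
  have hK0 : 0 ≤ K := (norm_nonneg _).trans (hK 0 ⟨le_rfl, zero_le_one⟩)
  obtain ⟨A, hA0, hA⟩ := iteratedDeriv_whithamSymbol_bound_of_one_le n
  have h2 : (0 : ℝ) < 2 ^ (-s) := by positivity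
  have key : ∀ x : ℝ, 0 ≤ x →
      |iteratedDeriv n whithamSymbol x| ≤ ((K + A + 1) * 2 ^ (-s)) * (1 + x) ^ s := fun x hx => by
    have hhalf : (2 : ℝ) ^ (-s) * (1 + x) ^ s = ((1 + x) / 2) ^ s := by
      rw [Real.div_rpow (by linarith) zero_le_two, Real.rpow_neg zero_le_two]
      field_simp
    rw [mul_assoc, hhalf]
    have hpos : 0 < ((1 + x) / 2) ^ s := by positivity
    rcases le_total x 1 with h | h
    · have h1 : 1 ≤ ((1 + x) / 2) ^ s :=
        Real.one_le_rpow_of_pos_of_le_one_of_nonpos (by linarith) (by linarith) hs0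
      have := hK x ⟨hx, h⟩
      rw [Real.norm_eq_abs] at this
      nlinarith
    · have h1 : x ^ s ≤ ((1 + x) / 2) ^ s :=
        Real.rpow_le_rpow_of_nonpos (by linarith) (by linarith) hs0
      have := hA x h
      nlinarith
  refine ⟨(K + A + 1) * 2 ^ (-s), by positivity, fun ξ => ?_⟩
  rcases abs_cases ξ with ⟨h, h'⟩ | ⟨h, h'⟩
  · rw [h]
    exact key ξ h'
  · rw [h, ← abs_iteratedDeriv_whithamSymbol_neg]
    exact key (-ξ) (by linarith)
end
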